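/- Let μ ∈ P be an integral weight and m ∈ ℤ_{≥1}. The set B(μ)^{*m} of m-fold concatenations of LS paths of shape μ, together with wt, ẽ_i, f̃_i, ε_i, φ_i, is a crystal, and the map B(μ)^{*m} → B(μ)^{⊗m} sending π₁ * ⋯ * π_m to π₁ ⊗ ⋯ ⊗ π_m is an isomorphism of crystals: it is a bijection that preserves wt, ε_i, φ_i and commutes with all ẽ_i and f̃_i. -/

import Mathlib

open scoped Classical
noncomputable section

namespace LSPaper

/-- The clamp of a real number to the interval `[0,1]`; paths `[0,1] → V` are
encoded as functions `ℝ → V` that factor through this clamp. -/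
def clamp01 (t : ℝ) : ℝ := max 0 (min 1 t)

variable {V : Type*} [AddCommGroup V] [Module ℝ V]

/-- The straight-line path `π_ν(t) = t ν` (clamped outside `[0,1]`). -/
def straight (ν : V) : ℝ → V := fun t => clamp01 t • ν

/-- The dilation `(mπ)(t) = m • π(t)`. -/
def dilate (m : ℕ) (f : ℝ → V) : ℝ → V := fun t => (m : ℝ) • f t

/-- The concatenation `π_1 * ⋯ * π_m` of a list of paths:
`(π_1 * ⋯ * π_m)(t) = Σ_{l<k} π_l(1) + π_k(mt - k + 1)` for
`(k-1)/m ≤ t ≤ k/m`. -/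
def concatList (l : List (ℝ → V)) : ℝ → V := fun t =>
  let m := l.length
  let k : ℕ := max 1 (min m (⌈(m : ℝ) * t⌉.toNat))
  (((l.take (k - 1)).map fun f => f 1).sum) +
    (l.getD (k - 1) 0) ((m : ℝ) * t - ((k : ℝ) - 1))

/-- Subdivision of a path into `m` pieces:
`π_k(t) = π(t/m + (k-1)/m) - π((k-1)/m)` (here `k` runs over `0, …, m-1`). -/
def subdiv (m : ℕ) (f : ℝ → V) : List (ℝ → V) :=
  List.ofFn fun k : Fin m => fun t : ℝ =>
    f ((clamp01 t + (k : ℝ)) / m) - f ((k : ℝ) / m)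

/-- The map `Σ_m : B(μ) → B(μ)^{⊗m}` (tensor factors encoded as a list):
dilate by `m`, then subdivide into `m` pieces. -/
def SigmaMap (m : ℕ) (f : ℝ → V) : List (ℝ → V) := subdiv m (dilate m f)

/-- The weight of a tensor product (encoded as a list of paths): the sum of
the weights of the factors. -/
def tensWt (l : List (ℝ → V)) : V := (l.map fun f => f 1).sum

/-- A symmetrizable generalized Cartan matrix together with a realization:
an integral weight lattice `P` inside a real vector space `V`, linearly
independent simple roots `α i ∈ P` and simple coroots (as linear functionals)
with `⟨α j, α i∨⟩ = a i j`, taking integer values on `P`. -/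
structure KacMoodyData (I : Type*) (V : Type*) [Fintype I] [DecidableEq I]
    [AddCommGroup V] [Module ℝ V] where
  a : I → I → ℤ
  d : I → ℤ
  P : AddSubgroup V
  α : I → V
  coroot : I → V →ₗ[ℝ] ℝ
  diag : ∀ i, a i i = 2
  offDiag : ∀ i j, i ≠ j → a i j ≤ 0
  zeroIff : ∀ i j, a i j = 0 ↔ a j i = 0
  dPos : ∀ i, 0 < d i
  symmetrizable : ∀ i j, d i * a i j = d j * a j i
  cartanPairing : ∀ i j, coroot i (α j) = (a i j : ℝ)
  rootsIndep : LinearIndependent ℝ α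
  corootsIndep : LinearIndependent ℝ coroot
  rootMem : ∀ i, α i ∈ P
  pairingInt : ∀ i, ∀ v ∈ P, ∃ n : ℤ, coroot i v = (n : ℝ)
  latticeFree : ∃ n : ℕ, Nonempty (P ≃+ (Fin n → ℤ))

namespace KacMoodyData

variable {I : Type*} [Fintype I] [DecidableEq I]
variable (K : KacMoodyData I V)

/-- The simple reflection `r_i(x) = x - ⟨x, α_i∨⟩ α_i` as a linear map. -/
def reflMap (i : I) : V →ₗ[ℝ] V := LinearMap.id - (K.coroot i).smulRight (K.α i)

lemma reflMap_invol (i : I) : Function.Involutive (K.reflMap i) := by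
  intro x
  have h2 : K.coroot i (K.α i) = 2 := by
    have h := K.cartanPairing i i
    rw [K.diag i] at h
    simpa using h
  simp only [reflMap, LinearMap.sub_apply, LinearMap.id_apply, LinearMap.smulRight_apply,
    map_sub, map_smul, smul_eq_mul, h2]
  module

/-- The simple reflection `r_i` as a linear automorphism of `V`. -/
def refl (i : I) : V ≃ₗ[ℝ] V :=
  { K.reflMap i with
    invFun := K.reflMap i
    left_inv := K.reflMap_invol i
    right_inv := K.reflMap_invol i }

/-- The Weyl group `W`, generated by the simple reflections. -/
def weylGroup : Subgroup (V ≃ₗ[ℝ] V) := Subgroup.closure (Set.range K.refl)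

/-- The Weyl group orbit `W μ` of an integral weight. -/
def orbit (μ : V) : Set V := {ν | ∃ w ∈ K.weylGroup, ν = w μ}

/-- `Q_+ = Σ_i ℤ_{≥0} α_i`. -/
def Qplus : Set V := {v | ∃ c : I → ℕ, v = ∑ i, (c i : ℝ) • K.α i}

/-- One step of the order on a Weyl group orbit:  `ν' = r_β(ν)` for a positive
real root `β = w α_i ∈ Q_+` (with `β∨ = w α_i∨`, `r_β = w r_i w⁻¹`) such that
`⟨ν, β∨⟩ < 0`. -/
def StepDown (ν ν' : V) : Prop :=
  ∃ w ∈ K.weylGroup, ∃ i : I, w (K.α i) ∈ K.Qplus ∧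
    K.coroot i (w.symm ν) < 0 ∧ ν' = w (K.refl i (w.symm ν))

/-- There is a chain `ν = ξ_0, ξ_1, …, ξ_p = ν'` of steps down. -/
def chainLen (p : ℕ) (ν ν' : V) : Prop :=
  ∃ ξ : ℕ → V, ξ 0 = ν ∧ ξ p = ν' ∧ ∀ q < p, K.StepDown (ξ q) (ξ (q + 1))

/-- `dist(ν, ν')`: the maximal length of a chain from `ν` down to `ν'`. -/
def dist (ν ν' : V) : ℕ := sSup {p | K.chainLen p ν ν'}

/-- A `σ`-chain for `(ν, ν')`: a sequence `ν = ξ_0 > ξ_1 > ⋯ > ξ_p = ν'` with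
`dist(ξ_{q-1}, ξ_q) = 1` and `σ ⟨ξ_{q-1}, β_q∨⟩ ∈ ℤ_{<0}`, where `β_q` is the
positive real root with `ξ_q = r_{β_q} ξ_{q-1}`. -/
def SigmaChain (σ : ℚ) (ν ν' : V) : Prop :=
  ∃ p : ℕ, 0 < p ∧ ∃ ξ : ℕ → V, ξ 0 = ν ∧ ξ p = ν' ∧
    ∀ q < p, K.dist (ξ q) (ξ (q + 1)) = 1 ∧
      ∃ w ∈ K.weylGroup, ∃ i : I, w (K.α i) ∈ K.Qplus ∧
        ξ (q + 1) = w (K.refl i (w.symm (ξ q))) ∧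
        ∃ n : ℤ, n < 0 ∧ (σ : ℝ) * K.coroot i (w.symm (ξ q)) = (n : ℝ)

/-- The combinatorial datum of a Lakshmibai–Seshadri path of shape `μ`:
a strictly decreasing sequence `ν_1 > ν_2 > ⋯ > ν_s` in `W μ` together with
rationals `0 = σ_0 < σ_1 < ⋯ < σ_s = 1` admitting `σ_u`-chains (the `ν`'s are
indexed here by `Fin s`, i.e. `0, …, s-1`). -/
structure LSData (K : KacMoodyData I V) (μ : V) where
  s : ℕ
  spos : 0 < s
  ν : Fin s → V
  τ : Fin (s + 1) → ℚ
  mem : ∀ u, ν u ∈ K.orbit μ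
  strictDec : ∀ (u : ℕ) (h : u + 1 < s),
    Relation.TransGen K.StepDown (ν ⟨u, Nat.lt_of_succ_lt h⟩) (ν ⟨u + 1, h⟩)
  τ_zero : τ 0 = 0
  τ_last : τ (Fin.last s) = 1
  τ_mono : StrictMono τ
  chainCond : ∀ (u : ℕ) (h : u + 1 < s),
    K.SigmaChain (τ ⟨u + 1, Nat.lt_succ_of_lt h⟩) (ν ⟨u, Nat.lt_of_succ_lt h⟩) (ν ⟨u + 1, h⟩)

/-- The piecewise-linear path `[0,1] → ℝ ⊗ P` associated with an LS datum:
`π(t) = Σ_{k<u} (σ_k - σ_{k-1}) ν_k + (t - σ_{u-1}) ν_u` for `σ_{u-1} ≤ t ≤ σ_u`,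
encoded as the function `ℝ → V`, `t ↦ Σ_k (min t σ_{k+1} - min t σ_k) • ν_k`
(which is constant for `t ≤ 0` and `t ≥ 1`). -/
def LSData.path {K : KacMoodyData I V} {μ : V} (π : K.LSData μ) : ℝ → V := fun t =>
  ∑ k : Fin π.s,
    ((min t ((π.τ k.succ : ℚ) : ℝ)) - (min t ((π.τ k.castSucc : ℚ) : ℝ))) • π.ν k

/-- `B(μ)`: the set of Lakshmibai–Seshadri paths of shape `μ`. -/
def B (μ : V) : Set (ℝ → V) := {f | ∃ π : K.LSData μ, f = π.path}

/-- `H_i^π(t) = ⟨π(t), α_i∨⟩`. -/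
def H (i : I) (f : ℝ → V) : ℝ → ℝ := fun t => K.coroot i (f t)

/-- `m_i^π = min {H_i^π(t) : t ∈ [0,1]}`. -/
def mval (i : I) (f : ℝ → V) : ℝ := sInf (K.H i f '' Set.Icc 0 1)

/-- The raising root operator `ẽ_i` (the underlying path, before testing
whether it is defined): with `t_1 = min {t : H_i^π(t) = m_i^π}` and
`t_0 = max {t ≤ t_1 : H_i^π(t) = m_i^π + 1}`, the new path is `π(t)` for
`t ≤ t_0`, `r_i(π(t) - π(t_0)) + π(t_0)` for `t_0 ≤ t ≤ t_1` and `π(t) + α_i`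
for `t ≥ t_1`. -/
def eraw (i : I) (f : ℝ → V) : ℝ → V := fun t =>
  let m := K.mval i f
  let t1 := sInf {t | t ∈ Set.Icc (0 : ℝ) 1 ∧ K.H i f t = m}
  let t0 := sSup {t | t ∈ Set.Icc (0 : ℝ) t1 ∧ K.H i f t = m + 1}
  if t ≤ t0 then f t
  else if t ≤ t1 then K.refl i (f t - f t0) + f t0
  else f t + K.α i

/-- The lowering root operator `f̃_i` (the underlying path): with
`t_0 = max {t : H_i^π(t) = m_i^π}` and `t_1 = min {t ≥ t_0 : H_i^π(t) = m_i^π + 1}`,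
the new path is `π(t)` for `t ≤ t_0`, `r_i(π(t) - π(t_0)) + π(t_0)` for
`t_0 ≤ t ≤ t_1` and `π(t) - α_i` for `t ≥ t_1`. -/
def fraw (i : I) (f : ℝ → V) : ℝ → V := fun t =>
  let m := K.mval i f
  let t0 := sSup {t | t ∈ Set.Icc (0 : ℝ) 1 ∧ K.H i f t = m}
  let t1 := sInf {t | t ∈ Set.Icc t0 1 ∧ K.H i f t = m + 1}
  if t ≤ t0 then f t
  else if t ≤ t1 then K.refl i (f t - f t0) + f t0
  else f t - K.α i

/-- The root operator `ẽ_i`, with value `none` (the formal element `0`) when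
`m_i^π = 0`. -/
def eop (i : I) (f : ℝ → V) : Option (ℝ → V) :=
  if K.mval i f = 0 then none else some (K.eraw i f)

/-- The root operator `f̃_i`, with value `none` (the formal element `0`) when
`H_i^π(1) - m_i^π = 0`. -/
def fop (i : I) (f : ℝ → V) : Option (ℝ → V) :=
  if K.H i f 1 - K.mval i f = 0 then none else some (K.fraw i f)

/-- `ẽ_i^n π` (with `ẽ_i 0 = 0`). -/
def eIter (i : I) (n : ℕ) (f : ℝ → V) : Option (ℝ → V) :=
  (fun o => o.bind (K.eop i))^[n] (some f)

/-- `f̃_i^n π` (with `f̃_i 0 = 0`). -/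
def fIter (i : I) (n : ℕ) (f : ℝ → V) : Option (ℝ → V) :=
  (fun o => o.bind (K.fop i))^[n] (some f)

/-- `ε_i(π) = max {n ≥ 0 : ẽ_i^n π ≠ 0}`. -/
def epsilon (i : I) (f : ℝ → V) : ℕ := sSup {n | K.eIter i n f ≠ none}

/-- `φ_i(π) = max {n ≥ 0 : f̃_i^n π ≠ 0}`. -/
def phi (i : I) (f : ℝ → V) : ℕ := sSup {n | K.fIter i n f ≠ none}

/-- The Weyl group action on a normal crystal:
`S_i b = f̃_i^{⟨wt b, α_i∨⟩} b` if `⟨wt b, α_i∨⟩ ≥ 0` and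
`S_i b = ẽ_i^{-⟨wt b, α_i∨⟩} b` if `⟨wt b, α_i∨⟩ ≤ 0`. -/
def Sop (i : I) (f : ℝ → V) : Option (ℝ → V) :=
  if 0 ≤ K.coroot i (f 1) then K.fIter i (⌊K.coroot i (f 1)⌋.toNat) f
  else K.eIter i ((-⌊K.coroot i (f 1)⌋).toNat) f

/-- `SWord K [i₁, …, i_k] b = S_{i₁} S_{i₂} ⋯ S_{i_k} b`. -/
def SWord (K : KacMoodyData I V) : List I → Option (ℝ → V) → Option (ℝ → V)
  | [], o => o
  | i :: rest, o => (SWord K rest o).bind (K.Sop i)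

/-- `b` is extremal: for each `w ∈ W` (as a word in simple reflections) and
`i ∈ I`, `ẽ_i (S_w b) = 0` if `⟨wt (S_w b), α_i∨⟩ ≥ 0` and `f̃_i (S_w b) = 0`
if `⟨wt (S_w b), α_i∨⟩ ≤ 0`. -/
def Extremal (f : ℝ → V) : Prop :=
  ∀ (l : List I) (g : ℝ → V), K.SWord l (some f) = some g →
    ∀ i : I, (0 ≤ K.coroot i (g 1) → K.eop i g = none) ∧
      (K.coroot i (g 1) ≤ 0 → K.fop i g = none)

/-- Application of a word in the Kashiwara operators (`true` stands for `ẽ`,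
`false` for `f̃`), leftmost entry applied first. -/
def applyWord (K : KacMoodyData I V) :
    List (I × Bool) → Option (ℝ → V) → Option (ℝ → V)
  | [], o => o
  | p :: rest, o =>
      applyWord K rest (o.bind fun f => if p.2 then K.eop p.1 f else K.fop p.1 f)

/-- `B(μ)^{*m}`: the set of `m`-fold concatenations of LS paths of shape `μ`. -/
def ConcatSet (μ : V) (m : ℕ) : Set (ℝ → V) :=
  {g | ∃ l : List (ℝ → V), l.length = m ∧ (∀ f ∈ l, f ∈ K.B μ) ∧ g = concatList l}

/-- `ε_i` of a tensor product (encoded as a list of paths, Kashiwara's rule):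
`ε_i(b₁ ⊗ b₂) = max (ε_i b₁) (ε_i b₂ - ⟨wt b₁, α_i∨⟩)`. -/
def tensEps (K : KacMoodyData I V) (i : I) : List (ℝ → V) → ℤ
  | [] => 0
  | [b] => (K.epsilon i b : ℤ)
  | b :: c :: rest =>
      max ((K.epsilon i b : ℤ)) (tensEps K i (c :: rest) - ⌊K.coroot i (b 1)⌋)

/-- `φ_i` of a tensor product (Kashiwara's rule):
`φ_i(b₁ ⊗ b₂) = max (φ_i b₂) (φ_i b₁ + ⟨wt b₂, α_i∨⟩)`. -/
def tensPhi (K : KacMoodyData I V) (i : I) : List (ℝ → V) → ℤ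
  | [] => 0
  | [b] => (K.phi i b : ℤ)
  | b :: c :: rest =>
      max (tensPhi K i (c :: rest)) ((K.phi i b : ℤ) + ⌊K.coroot i (tensWt (c :: rest))⌋)

/-- `ẽ_i` on a tensor product (Kashiwara's rule):
`ẽ_i(b₁ ⊗ b₂) = (ẽ_i b₁) ⊗ b₂` if `φ_i(b₁) ≥ ε_i(b₂)`, else `b₁ ⊗ (ẽ_i b₂)`. -/
def tensE (K : KacMoodyData I V) (i : I) : List (ℝ → V) → Option (List (ℝ → V))
  | [] => none
  | [b] => (K.eop i b).map fun b' => [b']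
  | b :: c :: rest =>
      if K.tensEps i (c :: rest) ≤ (K.phi i b : ℤ) then
        (K.eop i b).map fun b' => b' :: c :: rest
      else (tensE K i (c :: rest)).map fun r' => b :: r'

/-- `f̃_i` on a tensor product (Kashiwara's rule):
`f̃_i(b₁ ⊗ b₂) = (f̃_i b₁) ⊗ b₂` if `φ_i(b₁) > ε_i(b₂)`, else `b₁ ⊗ (f̃_i b₂)`. -/
def tensF (K : KacMoodyData I V) (i : I) : List (ℝ → V) → Option (List (ℝ → V))
  | [] => none
  | [b] => (K.fop i b).map fun b' => [b']
  | b :: c :: rest =>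
      if K.tensEps i (c :: rest) < (K.phi i b : ℤ) then
        (K.fop i b).map fun b' => b' :: c :: rest
      else (tensF K i (c :: rest)).map fun r' => b :: r'

/-- `ẽ_i^n` on tensor products. -/
def tensEIter (i : I) (n : ℕ) (l : List (ℝ → V)) : Option (List (ℝ → V)) :=
  (fun o => o.bind (K.tensE i))^[n] (some l)

/-- `f̃_i^n` on tensor products. -/
def tensFIter (i : I) (n : ℕ) (l : List (ℝ → V)) : Option (List (ℝ → V)) :=
  (fun o => o.bind (K.tensF i))^[n] (some l)

end KacMoodyData

end LSPaper

namespace LSPaper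

section Clamped

variable {I V : Type*} [Fintype I] [DecidableEq I] [AddCommGroup V] [Module ℝ V]

/-- `f` is determined by its values on `[0, 1]` and starts at the origin. -/
def IsClamped {V : Type*} [AddCommGroup V] (f : ℝ → V) : Prop := (∀ t ≤ 0, f t = 0) ∧ ∀ t, 1 ≤ t → f t = f 1

lemma KacMoodyData.LSData.isClamped {K : KacMoodyData I V} {μ : V} (π : K.LSData μ) : IsClamped π.path := by
  have hmono := π.τ_mono.monotone
  have h0 : ∀ k, (0 : ℝ) ≤ π.τ k := fun k => by
    exact_mod_cast π.τ_zero ▸ hmono (Fin.zero_le k)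
  have h1 : ∀ k, (π.τ k : ℝ) ≤ 1 := fun k => by
    exact_mod_cast π.τ_last ▸ hmono (Fin.le_last k)
  refine ⟨fun t ht => Finset.sum_eq_zero fun k _ => ?_, fun t ht =>
    Finset.sum_congr rfl fun k _ => ?_⟩
  · rw [min_eq_left (ht.trans (h0 _)), min_eq_left (ht.trans (h0 _)), sub_self, zero_smul]
  · simp only [min_eq_right (h1 _), min_eq_right ((h1 _).trans ht)]

end Clamped

end LSPaper

namespace LSPaper
namespace KacMoodyData

section AltWord

variable {I : Type*}

/-- The alternating word of length `k` in `s` and `t` whose last letter is `t`. -/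
def altWord : I → I → ℕ → List I
  | _, _, 0 => []
  | s, t, k + 1 => altWord t s k ++ [t]

lemma length_altWord (s t : I) (k : ℕ) : (altWord s t k).length = k := by
  induction k generalizing s t with
  | zero => rfl
  | succ k ih => simp [altWord, ih]

lemma altWord_succ_cons (s t : I) (k : ℕ) :
    altWord s t (k + 1) = (if Even k then t else s) :: altWord s t k := by
  induction k generalizing s t with
  | zero => simp [altWord]
  | succ k ih =>
    rw [altWord, ih t s, altWord, List.cons_append]
    congr 1
    by_cases h : Even k <;> simp [h, Nat.even_add_one]

lemma exists_altWord_suffix (s t : I) {k m : ℕ} (h : m ≤ k) :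
    ∃ y : List I, altWord s t k = y ++ altWord s t m ∧ y.length + m = k := by
  induction k, h using Nat.le_induction with
  | base => exact ⟨[], by simp⟩
  | succ k _ ih =>
    obtain ⟨y, hy, hl⟩ := ih
    exact ⟨_ :: y, by rw [altWord_succ_cons, hy, List.cons_append], by simp; omega⟩

/-- The coordinates of the image of `α_s` under an alternating word ending in `t`, with respect
to `α_s` and `α_t`, when `a_{st} = -a` and `a_{ts} = -b`. -/
def altCoeff (a b : ℤ) : ℕ → ℤ × ℤ
  | 0 => (1, 0)
  | k + 1 =>
    if k % 2 = 0 then ((altCoeff a b k).1, b * (altCoeff a b k).1 - (altCoeff a b k).2)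
    else (a * (altCoeff a b k).2 - (altCoeff a b k).1, (altCoeff a b k).2)

lemma altCoeff_nonneg_of_four_le {a b : ℤ} (ha : 0 ≤ a) (hb : 0 ≤ b) (hab : 4 ≤ a * b) (k : ℕ) :
    0 ≤ (altCoeff a b k).1 ∧ 0 ≤ (altCoeff a b k).2 := by
  suffices h : 0 ≤ (altCoeff a b k).1 ∧ 0 ≤ (altCoeff a b k).2 ∧
      (k % 2 = 0 → 2 * (altCoeff a b k).2 ≤ b * (altCoeff a b k).1) ∧
      (¬ k % 2 = 0 → 2 * (altCoeff a b k).1 ≤ a * (altCoeff a b k).2) from ⟨h.1, h.2.1⟩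
  induction k with
  | zero => simp [altCoeff, hb]
  | succ k ih =>
    obtain ⟨hc, hd, h1, h2⟩ := ih
    rw [altCoeff]
    by_cases hk : k % 2 = 0
    · have h := h1 hk
      rw [if_pos hk]
      exact ⟨hc, by linarith, fun _ => by omega, fun _ => by nlinarith⟩
    · have h := h2 hk
      rw [if_neg hk]
      exact ⟨by linarith, hd, fun _ => by nlinarith, fun _ => by omega⟩

end AltWord

section WeylGroup

variable {I V : Type*} [Fintype I] [DecidableEq I] [AddCommGroup V] [Module ℝ V]
  (K : KacMoodyData I V)

lemma refl_apply (i : I) (x : V) : K.refl i x = x - K.coroot i x • K.α i := rfl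

lemma refl_root (i j : I) : K.refl i (K.α j) = K.α j - (K.a i j : ℝ) • K.α i := by
  rw [refl_apply, K.cartanPairing]

lemma coroot_root_self (i : I) : K.coroot i (K.α i) = 2 := by
  rw [K.cartanPairing, K.diag]; norm_num

lemma refl_mul_self (i : I) : K.refl i * K.refl i = 1 :=
  LinearEquiv.ext (K.reflMap_invol i)

lemma coroot_refl_self (i : I) (x : V) : K.coroot i (K.refl i x) = -K.coroot i x := by
  rw [refl_apply, map_sub, map_smul, coroot_root_self, smul_eq_mul]; ring

/-- The product of simple reflections along a word. -/
def word (l : List I) : V ≃ₗ[ℝ] V := (l.map K.refl).prod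

lemma word_nil : K.word [] = 1 := rfl

lemma word_cons (i : I) (l : List I) : K.word (i :: l) = K.refl i * K.word l := by
  simp [word]

lemma word_append (l l' : List I) : K.word (l ++ l') = K.word l * K.word l' := by
  simp [word]

lemma word_singleton (i : I) : K.word [i] = K.refl i := by simp [word]

lemma word_concat_mul_refl (l : List I) (i : I) :
    K.word (l ++ [i]) * K.refl i = K.word l := by
  rw [word_append, word_singleton, mul_assoc, refl_mul_self, mul_one]

lemma refl_mem (i : I) : K.refl i ∈ K.weylGroup :=
  Subgroup.subset_closure ⟨i, rfl⟩

lemma inv_refl (i : I) : (K.refl i)⁻¹ = K.refl i :=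
  inv_eq_of_mul_eq_one_left (K.refl_mul_self i)

lemma inv_word (l : List I) : (K.word l)⁻¹ = K.word l.reverse := by
  induction l with
  | nil => simp [word_nil]
  | cons i l ih =>
    rw [word_cons, mul_inv_rev, ih, inv_refl, List.reverse_cons, word_append, word_singleton]

lemma exists_word {w : V ≃ₗ[ℝ] V} (hw : w ∈ K.weylGroup) : ∃ l, K.word l = w := by
  induction hw using Subgroup.closure_induction with
  | mem x hx =>
    obtain ⟨i, rfl⟩ := hx
    exact ⟨[i], K.word_singleton i⟩
  | one => exact ⟨[], rfl⟩
  | mul x y _ _ hx hy =>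
    obtain ⟨l, rfl⟩ := hx
    obtain ⟨l', rfl⟩ := hy
    exact ⟨l ++ l', K.word_append l l'⟩
  | inv x _ hx =>
    obtain ⟨l, rfl⟩ := hx
    exact ⟨l.reverse, (K.inv_word l).symm⟩

lemma root_mem_Qplus (i : I) : K.α i ∈ K.Qplus :=
  ⟨fun j => if j = i then 1 else 0, by simp⟩

lemma Qplus_add {x y : V} (hx : x ∈ K.Qplus) (hy : y ∈ K.Qplus) : x + y ∈ K.Qplus := by
  obtain ⟨c, rfl⟩ := hx
  obtain ⟨c', rfl⟩ := hy
  exact ⟨fun i => c i + c' i, by simp [add_smul, Finset.sum_add_distrib]⟩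

lemma Qplus_nsmul {x : V} (hx : x ∈ K.Qplus) (n : ℕ) : (n : ℝ) • x ∈ K.Qplus := by
  obtain ⟨c, rfl⟩ := hx
  exact ⟨fun i => n * c i, by simp [Finset.smul_sum, mul_smul]⟩

lemma Qplus_zsmul {x : V} (hx : x ∈ K.Qplus) {n : ℤ} (hn : 0 ≤ n) : (n : ℝ) • x ∈ K.Qplus := by
  lift n to ℕ using hn
  simpa using K.Qplus_nsmul hx n

/-- `x` is a shortest word for its group element, and right multiplication by `r_s` does not
make it shorter. -/
def RightReduced (s : I) (x : List I) : Prop :=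
  ∀ y : List I, K.word y = K.word x ∨ K.word y = K.word x * K.refl s → x.length ≤ y.length

lemma RightReduced.eq_altWord {s t : I} {x : List I} (h : K.RightReduced s x)
    (hx : ∀ z ∈ x, z = s ∨ z = t) : x = altWord s t x.length := by
  induction x using List.reverseRecOn generalizing s t with
  | nil => rfl
  | append_singleton y z ih =>
    have hz : z = t := by
      refine (hx z (by simp)).resolve_left fun hzs => ?_
      subst hzs
      have := h y (Or.inr (K.word_concat_mul_refl y z).symm)
      simp at this
    subst hz
    have hy : K.RightReduced z y := by
      rintro y' (h' | h')
      · have := h (y' ++ [z]) (Or.inl (by rw [word_append, h', ← word_append]))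
        simpa using this
      · have := h y' (Or.inl (by rw [h', word_append, word_singleton]))
        simp at this
        omega
    have hy' := ih hy fun u hu => (hx u (by simp [hu])).symm
    rw [List.length_append, List.length_singleton, altWord, ← hy']

lemma RightReduced.length_lt {s t : I} {k m : ℕ} (h : K.RightReduced s (altWord s t k))
    (hm : 0 < m) (braid : K.word (altWord s t m) = K.word (altWord t s m)) : k < m := by
  by_contra! hk
  obtain ⟨y, hy, hl⟩ := exists_altWord_suffix s t hk
  obtain ⟨m, rfl⟩ : ∃ n, m = n + 1 := ⟨m - 1, by omega⟩
  have := h (y ++ altWord s t m) (Or.inr (by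
    rw [hy, word_append, word_append, braid, altWord, mul_assoc, word_concat_mul_refl]))
  simp [length_altWord] at this
  omega

lemma altWord_root {s t : I} {a b : ℤ} (hst : K.a s t = -a) (hts : K.a t s = -b) (k : ℕ) :
    K.word (altWord s t k) (K.α s) =
      ((altCoeff a b k).1 : ℝ) • K.α s + ((altCoeff a b k).2 : ℝ) • K.α t := by
  induction k with
  | zero => simp [altWord, word_nil, altCoeff]
  | succ k ih =>
    rw [altWord_succ_cons, word_cons, LinearEquiv.mul_apply, ih, altCoeff]
    by_cases hk : Even k
    · simp only [hk, Nat.even_iff.1 hk, if_true, map_add, map_smul, refl_root, hts, K.diag]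
      push_cast
      module
    · simp only [hk, Nat.not_even_iff.1 hk, one_ne_zero, if_false, map_add, map_smul, refl_root,
        hst, K.diag]
      push_cast
      module

lemma refl_left_combination {s t : I} {a : ℤ} (hst : K.a s t = -a) (x : V) (p q : ℝ) :
    K.refl s (x + p • K.α s + q • K.α t) =
      x + (a * q - p - K.coroot s x) • K.α s + q • K.α t := by
  simp only [map_add, map_smul, refl_root, refl_apply K s x, hst, K.diag]
  push_cast
  module

lemma refl_right_combination {s t : I} {b : ℤ} (hts : K.a t s = -b) (x : V) (p q : ℝ) :
    K.refl t (x + p • K.α s + q • K.α t) =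
      x + p • K.α s + (b * p - q - K.coroot t x) • K.α t := by
  simp only [map_add, map_smul, refl_root, refl_apply K t x, hts, K.diag]
  push_cast
  module

lemma altCoeff_nonneg_of_lt_four {s t : I} {a b : ℤ} (ha : 0 ≤ a) (hb : 0 ≤ b)
    (hst : K.a s t = -a) (hts : K.a t s = -b) (hab : a * b < 4) (k : ℕ)
    (h : K.RightReduced s (altWord s t k)) :
    0 ≤ (altCoeff a b k).1 ∧ 0 ≤ (altCoeff a b k).2 := by
  have h0 : a = 0 ↔ b = 0 := by
    have := K.zeroIff s t
    rw [hst, hts] at this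
    simpa using this
  have hcases : (a = 0 ∧ b = 0) ∨ (a = 1 ∧ b = 1) ∨ (a = 1 ∧ b = 2) ∨ (a = 2 ∧ b = 1) ∨
      (a = 1 ∧ b = 3) ∨ (a = 3 ∧ b = 1) := by
    rcases eq_or_ne a 0 with h | h
    · exact Or.inl ⟨h, h0.1 h⟩
    · have hb' : b ≠ 0 := fun hb => h (h0.2 hb)
      have ha4 : a ≤ 3 := by nlinarith [show 1 ≤ b by omega]
      have hb4 : b ≤ 3 := by nlinarith [show 1 ≤ a by omega]
      interval_cases a <;> interval_cases b <;> simp_all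
  have hs := K.refl_left_combination hst
  have ht := K.refl_right_combination hts
  have start : ∀ x : V, x = x + (0 : ℝ) • K.α s + (0 : ℝ) • K.α t := fun x => by module
  have bound : ∀ m, 0 < m →
      (∀ x, K.word (altWord s t m) (x + (0 : ℝ) • K.α s + (0 : ℝ) • K.α t) =
        K.word (altWord t s m) (x + (0 : ℝ) • K.α s + (0 : ℝ) • K.α t)) → k < m := by
    refine fun m hm hx => h.length_lt K hm (LinearEquiv.ext fun x => ?_)
    rw [start x]
    exact hx x
  rcases hcases with ⟨rfl, rfl⟩ | ⟨rfl, rfl⟩ | ⟨rfl, rfl⟩ | ⟨rfl, rfl⟩ | ⟨rfl, rfl⟩ | ⟨rfl, rfl⟩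
  · have hk := bound 2 two_pos fun x => by
      simp only [altWord, List.nil_append, List.cons_append, word_cons, word_nil,
        LinearEquiv.mul_apply, LinearEquiv.coe_one, id, hs, ht]
      push_cast
      module
    interval_cases k <;> decide
  · have hk := bound 3 three_pos fun x => by
      simp only [altWord, List.nil_append, List.cons_append, word_cons, word_nil,
        LinearEquiv.mul_apply, LinearEquiv.coe_one, id, hs, ht]
      push_cast
      module
    interval_cases k <;> decide
  · have hk := bound 4 four_pos fun x => by
      simp only [altWord, List.nil_append, List.cons_append, word_cons, word_nil,
        LinearEquiv.mul_apply, LinearEquiv.coe_one, id, hs, ht]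
      push_cast
      module
    interval_cases k <;> decide
  · have hk := bound 4 four_pos fun x => by
      simp only [altWord, List.nil_append, List.cons_append, word_cons, word_nil,
        LinearEquiv.mul_apply, LinearEquiv.coe_one, id, hs, ht]
      push_cast
      module
    interval_cases k <;> decide
  · have hk := bound 6 (by norm_num) fun x => by
      simp only [altWord, List.nil_append, List.cons_append, word_cons, word_nil,
        LinearEquiv.mul_apply, LinearEquiv.coe_one, id, hs, ht]
      push_cast
      module
    interval_cases k <;> decide
  · have hk := bound 6 (by norm_num) fun x => by
      simp only [altWord, List.nil_append, List.cons_append, word_cons, word_nil,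
        LinearEquiv.mul_apply, LinearEquiv.coe_one, id, hs, ht]
      push_cast
      module
    interval_cases k <;> decide

lemma RightReduced.root_combination {s t : I} (hst : s ≠ t) {x : List I}
    (h : K.RightReduced s x) (hx : ∀ z ∈ x, z = s ∨ z = t) :
    ∃ c d : ℤ, 0 ≤ c ∧ 0 ≤ d ∧ K.word x (K.α s) = (c : ℝ) • K.α s + (d : ℝ) • K.α t := by
  obtain ⟨k, rfl⟩ : ∃ k, x = altWord s t k := ⟨_, h.eq_altWord K hx⟩
  have ha : 0 ≤ -K.a s t := by linarith [K.offDiag s t hst]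
  have hb : 0 ≤ -K.a t s := by linarith [K.offDiag t s hst.symm]
  have hc : 0 ≤ (altCoeff (-K.a s t) (-K.a t s) k).1 ∧
      0 ≤ (altCoeff (-K.a s t) (-K.a t s) k).2 := by
    rcases lt_or_ge (-K.a s t * -K.a t s) 4 with hab | hab
    · exact K.altCoeff_nonneg_of_lt_four ha hb (neg_neg _).symm (neg_neg _).symm hab k h
    · exact altCoeff_nonneg_of_four_le ha hb hab k
  exact ⟨_, _, hc.1, hc.2, K.altWord_root (neg_neg _).symm (neg_neg _).symm k⟩

lemma RightReduced.word_root_mem_Qplus {s : I} {l : List I} (h : K.RightReduced s l) :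
    K.word l (K.α s) ∈ K.Qplus := by
  induction hn : l.length using Nat.strong_induction_on generalizing l s with
  | _ n ih =>
  subst hn
  rcases List.eq_nil_or_concat' l with rfl | ⟨l', t, rfl⟩
  · exact K.root_mem_Qplus s
  have hts : t ≠ s := by
    rintro rfl
    have := h l' (Or.inr (K.word_concat_mul_refl l' t).symm)
    simp at this
  let S : Set ℕ := {n | ∃ v x : List I, v.length = n ∧ (∀ z ∈ x, z = s ∨ z = t) ∧
    K.word (v ++ x) = K.word (l' ++ [t]) ∧ (v ++ x).length = (l' ++ [t]).length}
  have hS : l'.length ∈ S := ⟨l', [t], rfl, by simp, rfl, rfl⟩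
  have hmin : ∀ n ∈ S, sInf S ≤ n := fun n hn => Nat.sInf_le hn
  obtain ⟨v, x, hv, hx, hw, hlen⟩ := Nat.sInf_mem ⟨_, hS⟩
  rw [← hv] at hmin
  have hv' : v.length < (l' ++ [t]).length := by
    have := hmin _ hS
    simp
    omega
  have hvred : ∀ z, (z = s ∨ z = t) → K.RightReduced z v := by
    rintro z hz y (hy | hy)
    · have := h (y ++ x) (Or.inl (by rw [word_append, hy, ← word_append, hw]))
      simp only [List.length_append] at this hlen
      omega
    · by_contra! hlt
      have hyx : K.word (y ++ z :: x) = K.word (l' ++ [t]) := by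
        rw [← hw, word_append, hy, word_cons, word_append, mul_assoc, ← mul_assoc (K.refl z),
          refl_mul_self, one_mul]
      have hle := h (y ++ z :: x) (Or.inl hyx)
      have := hmin y.length ⟨y, z :: x, rfl, by
        simp only [List.mem_cons, forall_eq_or_imp]
        exact ⟨hz, hx⟩, hyx, by
        simp only [List.length_append, List.length_cons] at hle hlen ⊢
        omega⟩
      omega
  have hxred : K.RightReduced s x := by
    rintro y (hy | hy)
    · have := h (v ++ y) (Or.inl (by rw [word_append, hy, ← word_append, hw]))
      simp only [List.length_append] at this hlen
      omega
    · have := h (v ++ y) (Or.inr (by rw [word_append, hy, ← hw, word_append, mul_assoc]))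
      simp only [List.length_append] at this hlen
      omega
  obtain ⟨c, d, hc, hd, hcd⟩ := hxred.root_combination K hts.symm hx
  rw [← hw, word_append, LinearEquiv.mul_apply, hcd, map_add, map_smul, map_smul]
  exact K.Qplus_add (K.Qplus_zsmul (ih _ hv' (hvred s (Or.inl rfl)) rfl) hc)
    (K.Qplus_zsmul (ih _ hv' (hvred t (Or.inr rfl)) rfl) hd)

/-- Every real root is positive or negative. -/
theorem root_mem_Qplus_or_neg {w : V ≃ₗ[ℝ] V} (hw : w ∈ K.weylGroup) (i : I) :
    w (K.α i) ∈ K.Qplus ∨ -w (K.α i) ∈ K.Qplus := by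
  have shortest : ∀ u ∈ K.weylGroup, ∃ l, K.word l = u ∧
      ∀ y, K.word y = u → l.length ≤ y.length := by
    intro u hu
    obtain ⟨l₀, hl₀⟩ := K.exists_word hu
    let S : Set ℕ := {n | ∃ l, K.word l = u ∧ l.length = n}
    have hS : l₀.length ∈ S := ⟨l₀, hl₀, rfl⟩
    obtain ⟨l, hl, hn⟩ := Nat.sInf_mem ⟨_, hS⟩
    exact ⟨l, hl, fun y hy => hn ▸ Nat.sInf_le ⟨y, hy, rfl⟩⟩
  obtain ⟨l, hl, hmin⟩ := shortest w hw
  obtain ⟨l', hl', hmin'⟩ := shortest (w * K.refl i) (mul_mem hw (K.refl_mem i))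
  rcases le_total l.length l'.length with hle | hle
  · left
    rw [← hl]
    refine RightReduced.word_root_mem_Qplus K ?_
    rintro y (hy | hy)
    · exact hmin y (hy.trans hl)
    · exact hle.trans (hmin' y (by rw [hy, hl]))
  · right
    have key : K.word l' (K.α i) = -w (K.α i) := by
      rw [hl', LinearEquiv.mul_apply, refl_root, K.diag, map_sub, map_smul]
      push_cast
      module
    rw [← key]
    refine RightReduced.word_root_mem_Qplus K ?_
    rintro y (hy | hy)
    · exact hmin' y (hy.trans hl')
    · refine hle.trans (hmin y ?_)
      rw [hy, hl', mul_assoc, refl_mul_self, mul_one]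

end WeylGroup
end KacMoodyData
end LSPaper

namespace LSPaper
namespace KacMoodyData

section LakshmibaiSeshadri

variable {I V : Type*} [Fintype I] [DecidableEq I] [AddCommGroup V] [Module ℝ V]
  (K : KacMoodyData I V)

/-- A real root `β = w α_j` is an integral combination of simple roots, and its coroot
`w α_j∨` is the corresponding rescaled combination of simple coroots. -/
lemma exists_root_coroot_coeff {w : V ≃ₗ[ℝ] V} (hw : w ∈ K.weylGroup) (j : I) :
    ∃ c : I → ℤ, w (K.α j) = ∑ k, (c k : ℝ) • K.α k ∧
      ∀ x, (K.d j : ℝ) * K.coroot j (w.symm x) =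
        ∑ k, (c k : ℝ) * K.d k * K.coroot k x := by
  obtain ⟨l, rfl⟩ := K.exists_word hw
  clear hw
  induction l with
  | nil =>
    refine ⟨fun k => if k = j then 1 else 0, ?_, fun x => ?_⟩
    · simp [word_nil]
    · simp only [word_nil, Int.cast_ite, Int.cast_one, Int.cast_zero, ite_mul, one_mul, zero_mul,
        Finset.sum_ite_eq', Finset.mem_univ, if_true]
      rfl
  | cons i l ih =>
    obtain ⟨c, hc, hx⟩ := ih
    refine ⟨fun k => c k - if k = i then ∑ m, c m * K.a i m else 0, ?_, fun x => ?_⟩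
    · rw [word_cons, LinearEquiv.mul_apply, hc, refl_apply]
      simp only [map_sum, map_smul, K.cartanPairing, Int.cast_sub, sub_smul,
        Finset.sum_sub_distrib, smul_eq_mul]
      congr 1
      simp [ite_smul]
    · have hsymm : (K.word (i :: l)).symm x = (K.word l).symm (K.refl i x) := by
        rw [LinearEquiv.symm_apply_eq, word_cons, LinearEquiv.mul_apply,
          LinearEquiv.apply_symm_apply]
        exact (K.reflMap_invol i x).symm
      rw [hsymm, hx, refl_apply]
      simp only [map_sub, map_smul, K.cartanPairing, Int.cast_sub, sub_mul, mul_sub,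
        Finset.sum_sub_distrib, smul_eq_mul]
      congr 1
      simp only [Int.cast_ite, Int.cast_zero, ite_mul, zero_mul, Finset.sum_ite_eq',
        Finset.mem_univ, if_true, Int.cast_sum, Int.cast_mul, Finset.sum_mul]
      refine Finset.sum_congr rfl fun k _ => ?_
      have h : (K.d i : ℝ) * K.a i k = K.d k * K.a k i := by exact_mod_cast K.symmetrizable i k
      linear_combination (-(c k : ℝ) * K.coroot i x) * h

lemma exists_int_coroot_root {w : V ≃ₗ[ℝ] V} (hw : w ∈ K.weylGroup) (i j : I) :
    ∃ n : ℤ, K.coroot i (w (K.α j)) = n := by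
  obtain ⟨c, hc, -⟩ := K.exists_root_coroot_coeff hw j
  refine ⟨∑ k, c k * K.a i k, ?_⟩
  rw [hc]
  simp [K.cartanPairing]

lemma weylGroup_apply_mem {w : V ≃ₗ[ℝ] V} (hw : w ∈ K.weylGroup) {v : V} (hv : v ∈ K.P) :
    w v ∈ K.P := by
  obtain ⟨l, rfl⟩ := K.exists_word hw
  clear hw
  induction l with
  | nil => exact hv
  | cons i l ih =>
    obtain ⟨n, hn⟩ := K.pairingInt i _ ih
    rw [word_cons, LinearEquiv.mul_apply, refl_apply, hn, Int.cast_smul_eq_zsmul]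
    exact K.P.sub_mem ih (K.P.zsmul_mem (K.rootMem i) n)

lemma conj_refl_apply (w : V ≃ₗ[ℝ] V) (j : I) (x : V) :
    w (K.refl j (w.symm x)) = x - K.coroot j (w.symm x) • w (K.α j) := by
  rw [refl_apply, map_sub, map_smul, LinearEquiv.apply_symm_apply]

/-- If `r_i` makes the positive real root `w α_j` negative, then `w α_j` is a multiple of `α_i`
and the coroots are proportional with the inverse ratio. -/
lemma coroot_eq_of_neg_refl_mem {w : V ≃ₗ[ℝ] V} (hw : w ∈ K.weylGroup) {i j : I}
    (hpos : w (K.α j) ∈ K.Qplus) (hneg : -K.refl i (w (K.α j)) ∈ K.Qplus) :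
    ∃ c : ℤ, ∀ x, K.coroot i x = c * K.coroot j (w.symm x) := by
  obtain ⟨c, hc, hx⟩ := K.exists_root_coroot_coeff hw j
  obtain ⟨n, hn⟩ := hpos
  obtain ⟨n', hn'⟩ := hneg
  have hcn : ∀ k, (c k : ℝ) = n k := by
    have h : ∑ k, ((c k : ℝ) - n k) • K.α k = 0 := by
      simp only [sub_smul, Finset.sum_sub_distrib]
      rw [← hc, ← hn, sub_self]
    intro k
    exact sub_eq_zero.1 (Fintype.linearIndependent_iff.1 K.rootsIndep _ h k)
  have hc0 : ∀ k, k ≠ i → (c k : ℝ) = 0 := by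
    have h : ∑ k, ((n k : ℝ) + n' k -
        if k = i then K.coroot i (w (K.α j)) else 0) • K.α k = 0 := by
      simp only [sub_smul, add_smul, Finset.sum_sub_distrib, Finset.sum_add_distrib, ite_smul,
        zero_smul, Finset.sum_ite_eq', Finset.mem_univ, if_true]
      rw [← hn, ← hn', refl_apply]
      module
    intro k hk
    have h1 := Fintype.linearIndependent_iff.1 K.rootsIndep _ h k
    rw [if_neg hk, sub_zero] at h1
    rw [hcn]
    have h2 : (0 : ℝ) ≤ n k := Nat.cast_nonneg _
    have h3 : (0 : ℝ) ≤ n' k := Nat.cast_nonneg _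
    linarith
  have hroot : w (K.α j) = (c i : ℝ) • K.α i := by
    rw [hc, Finset.sum_eq_single i (fun k _ hk => by rw [hc0 k hk, zero_smul]) (by simp)]
  have hcoroot : ∀ x, (K.d j : ℝ) * K.coroot j (w.symm x) = c i * K.d i * K.coroot i x := by
    intro x
    rw [hx, Finset.sum_eq_single i (fun k _ hk => by rw [hc0 k hk]; ring) (by simp)]
  have hd : (K.d j : ℝ) = c i * c i * K.d i := by
    have h := hcoroot (w (K.α j))
    rw [LinearEquiv.symm_apply_apply, hroot, map_smul, coroot_root_self, coroot_root_self,
      smul_eq_mul] at h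
    linarith
  have hdj : (0 : ℝ) < K.d j := by exact_mod_cast K.dPos j
  have hdi : (0 : ℝ) < K.d i := by exact_mod_cast K.dPos i
  have hci : (c i : ℝ) ≠ 0 := by
    intro h
    rw [h] at hd
    linarith
  refine ⟨c i, fun x => ?_⟩
  have h := hcoroot x
  rw [hd] at h
  have h' : (c i * K.d i : ℝ) * (c i * K.coroot j (w.symm x) - K.coroot i x) = 0 := by
    linarith
  rcases mul_eq_zero.1 h' with h' | h'
  · exact absurd h' (mul_ne_zero hci hdi.ne')
  · linarith

lemma dist_ne_one_of_chainLen {p : ℕ} (hp : 1 < p) {x y : V} (h : K.chainLen p x y) :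
    K.dist x y ≠ 1 := by
  intro h1
  by_cases hb : BddAbove {p | K.chainLen p x y}
  · have := le_csSup hb h
    rw [dist] at h1
    omega
  · rw [dist, Nat.sSup_of_not_bddAbove hb] at h1
    exact zero_ne_one h1

lemma stepDown_refl {i : I} {x : V} (h : K.coroot i x < 0) : K.StepDown x (K.refl i x) :=
  ⟨1, one_mem _, i, K.root_mem_Qplus i, h, rfl⟩

/-- A covering step across the wall of `α_i` is the simple reflection `r_i`: the coroot of the
reflection is proportional to `α_i∨`. -/
lemma coroot_eq_of_dist_eq_one {w : V ≃ₗ[ℝ] V} (hw : w ∈ K.weylGroup) {i j : I} {x y : V}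
    (hpos : w (K.α j) ∈ K.Qplus) (hx : K.coroot j (w.symm x) < 0)
    (hy : y = w (K.refl j (w.symm x))) (hdist : K.dist x y = 1)
    (hxi : K.coroot i x < 0) (hyi : 0 < K.coroot i y) :
    ∃ c : ℤ, K.coroot i x = c * K.coroot j (w.symm x) := by
  have hmem : K.refl i * w ∈ K.weylGroup := mul_mem (K.refl_mem i) hw
  rcases K.root_mem_Qplus_or_neg hmem j with h | h
  · refine absurd hdist (K.dist_ne_one_of_chainLen (p := 3) (by norm_num) ?_)
    have hsymm : (K.refl i * w).symm (K.refl i x) = w.symm x := by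
      rw [LinearEquiv.symm_apply_eq, LinearEquiv.mul_apply, LinearEquiv.apply_symm_apply]
    refine ⟨fun q => if q = 0 then x else if q = 1 then K.refl i x
      else if q = 2 then K.refl i y else y, by simp, by simp, fun q hq => ?_⟩
    interval_cases q
    · simpa using K.stepDown_refl hxi
    · simp only [one_ne_zero, if_false, if_true, Nat.reduceAdd, OfNat.ofNat_ne_zero,
        OfNat.ofNat_ne_one]
      refine ⟨K.refl i * w, hmem, j, h, by rwa [hsymm], ?_⟩
      rw [hsymm, LinearEquiv.mul_apply, ← hy]
    · have h' := K.stepDown_refl (i := i) (x := K.refl i y) (by rw [coroot_refl_self]; linarith)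
      have hyy : K.refl i (K.refl i y) = y := K.reflMap_invol i y
      rw [hyy] at h'
      simpa using h'
  · obtain ⟨c, hc⟩ := K.coroot_eq_of_neg_refl_mem hw hpos (i := i) h
    exact ⟨c, hc x⟩

lemma SigmaChain.exists_int {σ : ℚ} (hσ : 0 < σ) {x y : V} (h : K.SigmaChain σ x y) (i : I) :
    (∃ n : ℤ, (σ : ℝ) * (K.coroot i y - K.coroot i x) = n) ∧
      (K.coroot i x ≤ 0 → 0 ≤ K.coroot i y → ∃ n : ℤ, (σ : ℝ) * K.coroot i x = n) := by
  obtain ⟨p, hp, ξ, rfl, rfl, hξ⟩ := h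
  have hσ' : (0 : ℝ) < σ := by exact_mod_cast hσ
  have hint : ∀ q ≤ p, ∃ n : ℤ, (σ : ℝ) * (K.coroot i (ξ q) - K.coroot i (ξ 0)) = n := by
    intro q
    induction q with
    | zero => exact fun _ => ⟨0, by simp⟩
    | succ q ih =>
      intro hq
      obtain ⟨n, hn⟩ := ih (by omega)
      obtain ⟨-, w, hw, j, -, hnext, n', -, hn'⟩ := hξ q (by omega)
      obtain ⟨c, hc⟩ := K.exists_int_coroot_root hw i j
      refine ⟨n - n' * c, ?_⟩
      rw [hnext, conj_refl_apply, map_sub, map_smul, smul_eq_mul, hc]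
      push_cast
      rw [← hn, ← hn']
      ring
  refine ⟨hint p le_rfl, fun hx hy => ?_⟩
  rcases hx.eq_or_lt with hx | hx
  · exact ⟨0, by simp [hx]⟩
  have hex : ∃ q, 0 ≤ K.coroot i (ξ q) := ⟨p, hy⟩
  obtain ⟨q, hq⟩ : ∃ q, Nat.find hex = q + 1 := by
    refine Nat.exists_eq_succ_of_ne_zero fun h0 => ?_
    have := Nat.find_spec hex
    rw [h0] at this
    linarith
  have hqp : q + 1 ≤ p := hq ▸ Nat.find_min' hex hy
  have hq1 : 0 ≤ K.coroot i (ξ (q + 1)) := hq ▸ Nat.find_spec hex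
  have hq0 : K.coroot i (ξ q) < 0 := not_le.1 (Nat.find_min hex (by omega))
  rcases hq1.eq_or_lt with hz | hpos
  · obtain ⟨n, hn⟩ := hint (q + 1) hqp
    refine ⟨-n, ?_⟩
    push_cast
    rw [← hn, ← hz]
    ring
  · obtain ⟨hdist, w, hw, j, hβ, hnext, n', hneg, hn'⟩ := hξ q (by omega)
    have hlt : K.coroot j (w.symm (ξ q)) < 0 := by
      have : (n' : ℝ) < 0 := by exact_mod_cast hneg
      by_contra! hge
      nlinarith [mul_nonneg hσ'.le hge]
    obtain ⟨c, hc⟩ := K.coroot_eq_of_dist_eq_one hw hβ hlt hnext hdist hq0 hpos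
    obtain ⟨n, hn⟩ := hint q (by omega)
    refine ⟨c * n' - n, ?_⟩
    push_cast
    rw [← hn, ← hn']
    linear_combination (σ : ℝ) * hc

end LakshmibaiSeshadri

section PiecewiseLinear

/-- The piecewise linear function with breakpoints `τ k` and slopes `h k`. -/
def piecewiseLinear (s : ℕ) (τ h : ℕ → ℝ) (t : ℝ) : ℝ :=
  ∑ k ∈ Finset.range s, (min t (τ (k + 1)) - min t (τ k)) * h k

variable {s : ℕ} {τ h : ℕ → ℝ}

lemma piecewiseLinear_continuous (s : ℕ) (τ h : ℕ → ℝ) :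
    Continuous (piecewiseLinear s τ h) := by
  unfold piecewiseLinear
  fun_prop

lemma breakpoints_mono (hτ : ∀ k < s, τ k < τ (k + 1)) {j k : ℕ} (hjk : j ≤ k) (hk : k ≤ s) :
    τ j ≤ τ k := by
  induction k, hjk using Nat.le_induction with
  | base => exact le_rfl
  | succ k _ ih => exact (ih (by omega)).trans (hτ k (by omega)).le

lemma piecewiseLinear_sub (hτ : ∀ k < s, τ k < τ (k + 1)) {k : ℕ} (hk : k < s) {t u : ℝ}
    (ht : τ k ≤ t) (ht' : t ≤ τ (k + 1)) (hu : τ k ≤ u) (hu' : u ≤ τ (k + 1)) :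
    piecewiseLinear s τ h t - piecewiseLinear s τ h u = (t - u) * h k := by
  rw [piecewiseLinear, piecewiseLinear, ← Finset.sum_sub_distrib, Finset.sum_eq_single k]
  · rw [min_eq_left ht', min_eq_right ht, min_eq_left hu', min_eq_right hu]
    ring
  · intro j hj hjk
    have hj := Finset.mem_range.1 hj
    rcases lt_or_gt_of_ne hjk with hlt | hgt
    · have h1 := breakpoints_mono hτ (show j + 1 ≤ k by omega) hk.le
      have h2 := hτ j hj
      rw [min_eq_right (h1.trans ht), min_eq_right (h1.trans hu),
        min_eq_right (h2.le.trans (h1.trans ht)), min_eq_right (h2.le.trans (h1.trans hu))]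
      ring
    · have h1 := breakpoints_mono hτ (show k + 1 ≤ j by omega) hj.le
      have h2 := hτ j hj
      rw [min_eq_left (ht'.trans h1), min_eq_left (hu'.trans h1),
        min_eq_left (ht'.trans (h1.trans h2.le)), min_eq_left (hu'.trans (h1.trans h2.le))]
      ring
  · intro hk'
    exact absurd (Finset.mem_range.2 hk) hk'

lemma piecewiseLinear_breakpoint (hτ0 : τ 0 = 0) (hτ : ∀ k < s, τ k < τ (k + 1))
    (hjump : ∀ k, k + 1 < s → ∃ n : ℤ, τ (k + 1) * (h (k + 1) - h k) = n) {k : ℕ} (hk : k < s) :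
    ∃ n : ℤ, piecewiseLinear s τ h (τ (k + 1)) - τ (k + 1) * h k = n := by
  have hlin : ∀ k < s, piecewiseLinear s τ h (τ (k + 1)) - piecewiseLinear s τ h (τ k) =
      (τ (k + 1) - τ k) * h k := fun k hk =>
    piecewiseLinear_sub hτ hk (hτ k hk).le le_rfl le_rfl (hτ k hk).le
  induction k with
  | zero =>
    have h0 : piecewiseLinear s τ h (τ 0) = 0 := by
      refine Finset.sum_eq_zero fun j hj => ?_
      have hj := Finset.mem_range.1 hj
      rw [min_eq_left (breakpoints_mono hτ (Nat.zero_le _) hj),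
        min_eq_left (breakpoints_mono hτ (Nat.zero_le _) hj.le)]
      ring
    refine ⟨0, ?_⟩
    have := hlin 0 hk
    rw [h0, hτ0] at this
    push_cast
    linarith
  | succ k ih =>
    obtain ⟨n, hn⟩ := ih (by omega)
    obtain ⟨n', hn'⟩ := hjump k hk
    refine ⟨n - n', ?_⟩
    push_cast
    rw [← hn, ← hn']
    linarith [hlin (k + 1) hk]

lemma piecewiseLinear_valley (hτ0 : τ 0 = 0) (hτs : τ s = 1) (hτ : ∀ k < s, τ k < τ (k + 1))
    (hjump : ∀ k, k + 1 < s → ∃ n : ℤ, τ (k + 1) * (h (k + 1) - h k) = n)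
    (hturn : ∀ k, k + 1 < s → h k ≤ 0 → 0 ≤ h (k + 1) → ∃ n : ℤ, τ (k + 1) * h k = n)
    {a b c : ℝ} {n : ℤ} (ha : 0 ≤ a) (hab : a ≤ b) (hbc : b ≤ c) (hc : c ≤ 1)
    (hFb : piecewiseLinear s τ h b < n + 1) (hFa : n + 1 ≤ piecewiseLinear s τ h a)
    (hFc : n + 1 ≤ piecewiseLinear s τ h c) :
    ∃ x, a ≤ x ∧ x ≤ c ∧ piecewiseLinear s τ h x ≤ n := by
  set F := piecewiseLinear s τ h with hF
  have hcont : Continuous F := piecewiseLinear_continuous s τ h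
  obtain ⟨x₀, hx₀, hmin⟩ := (isCompact_Icc (a := a) (b := c)).exists_isMinOn
    ⟨b, hab, hbc⟩ hcont.continuousOn
  let S : Set ℝ := Set.Icc a c ∩ F ⁻¹' {F x₀}
  have hSclosed : IsClosed S := isClosed_Icc.inter (isClosed_singleton.preimage hcont)
  have hSbdd : BddBelow S := ⟨a, fun x hx => hx.1.1⟩
  obtain ⟨⟨hxa, hxc⟩, hxF⟩ : sInf S ∈ S := hSclosed.csInf_mem ⟨x₀, hx₀, rfl⟩ hSbdd
  have hfirst : ∀ y ∈ S, sInf S ≤ y := fun y hy => csInf_le hSbdd hy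
  generalize sInf S = x at hxa hxc hxF hfirst
  have hxF : F x = F x₀ := hxF
  have hminx : ∀ y, a ≤ y → y ≤ c → F x ≤ F y := fun y h1 h2 => hxF ▸ hmin ⟨h1, h2⟩
  refine ⟨x, hxa, hxc, ?_⟩
  by_contra! hxn
  have hxlt : F x < n + 1 := (hminx b hab hbc).trans_lt hFb
  have hxa : a < x := lt_of_le_of_ne hxa fun h => by rw [h] at hFa; linarith
  have hxc : x < c := lt_of_le_of_ne hxc fun h => by rw [← h] at hFc; linarith
  have hex : ∃ k, x ≤ τ k := ⟨s, by linarith⟩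
  obtain ⟨k, hk⟩ : ∃ k, Nat.find hex = k + 1 := by
    refine Nat.exists_eq_succ_of_ne_zero fun h0 => ?_
    have := Nat.find_spec hex
    rw [h0] at this
    linarith
  have hks : k < s := by
    have := Nat.find_min' hex (show x ≤ τ s by linarith)
    omega
  have hxk : x ≤ τ (k + 1) := hk ▸ Nat.find_spec hex
  have hkx : τ k < x := not_le.1 (Nat.find_min hex (by omega))
  have hslope : h k < 0 := by
    by_contra! hge
    have hy1 : max a (τ k) < x := max_lt hxa hkx
    have hsub := piecewiseLinear_sub (h := h) hτ hks hkx.le hxk (le_max_right a (τ k))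
      (hy1.le.trans hxk)
    have hle := hminx (max a (τ k)) (le_max_left _ _) (by linarith)
    have h0 := mul_nonneg (sub_nonneg.2 hy1.le) hge
    exact absurd (hfirst _ ⟨⟨le_max_left _ _, by linarith⟩,
      (show F (max a (τ k)) = F x₀ by linarith)⟩) (not_le.2 hy1)
  have hright : ∀ j < s, τ j ≤ x → x < τ (j + 1) → 0 ≤ h j := by
    intro j hj h1 h2
    by_contra! hneg
    have hy : x < min c (τ (j + 1)) := lt_min hxc h2
    have hsub := piecewiseLinear_sub (h := h) hτ hj (h1.trans hy.le) (min_le_right c _) h1 h2.le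
    have hle := hminx (min c (τ (j + 1))) (by linarith) (min_le_left _ _)
    have h0 := mul_neg_of_pos_of_neg (sub_pos.2 hy) hneg
    linarith
  rcases hxk.lt_or_eq with hlt | heq
  · linarith [hright k hks hkx.le hlt]
  · have hk1 : k + 1 < s := by
      refine lt_of_le_of_ne hks fun h => ?_
      rw [h, hτs] at heq
      linarith
    have hnn := hright (k + 1) hk1 heq.ge (heq.trans_lt (hτ _ hk1))
    obtain ⟨p, hp⟩ := piecewiseLinear_breakpoint hτ0 hτ hjump hks
    obtain ⟨q, hq⟩ := hturn k hk1 hslope.le hnn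
    have hFx : F x = ((p + q : ℤ) : ℝ) := by
      push_cast
      rw [← hp, ← hq, heq]
      ring
    rw [hFx] at hxn hxlt
    have h1 : n < p + q := by exact_mod_cast hxn
    have h2 : p + q < n + 1 := by exact_mod_cast hxlt
    omega

end PiecewiseLinear

section IntegralPath

variable {I V : Type*} [Fintype I] [DecidableEq I] [AddCommGroup V] [Module ℝ V]

/-- Paths, constant outside `[0,1]`, whose height function `H_i` is continuous, ends at an integer
and has integral local minima, in the form: an excursion below an integer level `n + 1` reaches
the level `n`. -/
structure IsIntegralPath (K : KacMoodyData I V) (i : I) (f : ℝ → V) : Prop where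
  eq_zero : ∀ t ≤ 0, f t = 0
  eq_one : ∀ t, 1 ≤ t → f t = f 1
  continuous : Continuous (K.H i f)
  int_one : ∃ n : ℤ, K.H i f 1 = n
  valley : ∀ a b c (n : ℤ), 0 ≤ a → a ≤ b → b ≤ c → c ≤ 1 → K.H i f b < n + 1 →
    n + 1 ≤ K.H i f a → n + 1 ≤ K.H i f c → ∃ x, a ≤ x ∧ x ≤ c ∧ K.H i f x ≤ n

variable {K : KacMoodyData I V}

theorem LSData.isIntegralPath {μ : V} (hμ : μ ∈ K.P) (π : K.LSData μ) (i : I) :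
    K.IsIntegralPath i π.path := by
  let τ : ℕ → ℝ := fun k => if hk : k < π.s + 1 then π.τ ⟨k, hk⟩ else 0
  let h : ℕ → ℝ := fun k => if hk : k < π.s then K.coroot i (π.ν ⟨k, hk⟩) else 0
  have hτ_eq : ∀ k (hk : k < π.s + 1), τ k = π.τ ⟨k, hk⟩ := fun k hk => dif_pos hk
  have hh_eq : ∀ k (hk : k < π.s), h k = K.coroot i (π.ν ⟨k, hk⟩) := fun k hk => dif_pos hk
  have hH : K.H i π.path = piecewiseLinear π.s τ h := by
    funext t
    rw [H, LSData.path, map_sum, piecewiseLinear, ← Fin.sum_univ_eq_sum_range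
      (fun k => (min t (τ (k + 1)) - min t (τ k)) * h k)]
    refine Finset.sum_congr rfl fun k _ => ?_
    rw [map_smul, smul_eq_mul, hh_eq k k.2, hτ_eq k (by omega), hτ_eq (k + 1) (by omega)]
    rfl
  have hτ0 : τ 0 = 0 := by
    rw [hτ_eq 0 (by omega)]
    exact_mod_cast π.τ_zero
  have hτs : τ π.s = 1 := by
    rw [hτ_eq π.s (by omega)]
    exact_mod_cast π.τ_last
  have hτ : ∀ k < π.s, τ k < τ (k + 1) := by
    intro k hk
    rw [hτ_eq k (by omega), hτ_eq (k + 1) (by omega)]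
    have : π.τ ⟨k, by omega⟩ < π.τ ⟨k + 1, by omega⟩ := π.τ_mono (by simp)
    exact_mod_cast this
  have hchain : ∀ k, k + 1 < π.s → (∃ n : ℤ, τ (k + 1) * (h (k + 1) - h k) = n) ∧
      (h k ≤ 0 → 0 ≤ h (k + 1) → ∃ n : ℤ, τ (k + 1) * h k = n) := by
    intro k hk
    rw [hτ_eq (k + 1) (by omega), hh_eq k (by omega), hh_eq (k + 1) hk]
    refine SigmaChain.exists_int K ?_ (π.chainCond k hk) i
    rw [← π.τ_zero]
    exact π.τ_mono (by simp [Fin.lt_def])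
  refine ⟨π.isClamped.1, π.isClamped.2, ?_, ?_, ?_⟩
  · rw [hH]
    exact piecewiseLinear_continuous _ _ _
  · have hs := π.spos
    obtain ⟨n, hn⟩ := piecewiseLinear_breakpoint hτ0 hτ (fun k hk => (hchain k hk).1)
      (show π.s - 1 < π.s by omega)
    obtain ⟨w, hw, hν⟩ := π.mem ⟨π.s - 1, by omega⟩
    obtain ⟨n', hn'⟩ := K.pairingInt i _ (K.weylGroup_apply_mem hw hμ)
    rw [Nat.sub_add_cancel hs, hτs, ← hH, hh_eq _ (by omega), hν, hn'] at hn
    refine ⟨n + n', ?_⟩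
    push_cast
    linarith
  · intro a b c n ha hab hbc hc
    rw [hH]
    exact piecewiseLinear_valley hτ0 hτs hτ (fun k hk => (hchain k hk).1)
      (fun k hk => (hchain k hk).2) ha hab hbc hc

end IntegralPath

end KacMoodyData
end LSPaper

namespace LSPaper
namespace KacMoodyData

section RootStep

variable {I V : Type*} [Fintype I] [DecidableEq I] [AddCommGroup V] [Module ℝ V]

/-- The relation `g = ẽ_i f` (equivalently `f = f̃_i g`), where the path is reflected on
`[t₀, t₁]` and `n` is the minimum of `H_i^f`. -/
structure IsRootStep (K : KacMoodyData I V) (i : I) (f g : ℝ → V) (t₀ t₁ : ℝ) (n : ℤ) :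
    Prop where
  zero_le : 0 ≤ t₀
  lt : t₀ < t₁
  le_one : t₁ ≤ 1
  start : K.H i f t₀ = n + 1
  finish : K.H i f t₁ = n
  left : ∀ t, 0 ≤ t → t ≤ t₀ → n + 1 ≤ K.H i f t
  mid : ∀ t, t₀ < t → t < t₁ → n < K.H i f t ∧ K.H i f t < n + 1
  right : ∀ t, t₁ ≤ t → t ≤ 1 → n ≤ K.H i f t
  eq_ite : ∀ t, g t = if t ≤ t₀ then f t
    else if t ≤ t₁ then f t + (n + 1 - K.H i f t) • K.α i else f t + K.α i

namespace IsRootStep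

variable {K : KacMoodyData I V} {i : I} {f g : ℝ → V} {t₀ t₁ t : ℝ} {n : ℤ}

lemma eq_of_le (h : K.IsRootStep i f g t₀ t₁ n) (ht : t ≤ t₀) : g t = f t := by
  rw [h.eq_ite, if_pos ht]

lemma eq_of_mid (h : K.IsRootStep i f g t₀ t₁ n) (ht : t₀ ≤ t) (ht' : t ≤ t₁) :
    g t = f t + (n + 1 - K.H i f t) • K.α i := by
  rw [h.eq_ite]
  split_ifs with h1
  · obtain rfl := le_antisymm ht h1
    rw [h.start, sub_self, zero_smul, add_zero]
  · rfl

lemma eq_of_ge (h : K.IsRootStep i f g t₀ t₁ n) (ht : t₁ ≤ t) : g t = f t + K.α i := by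
  rw [h.eq_ite, if_neg (not_le.2 (h.lt.trans_le ht))]
  split_ifs with h1
  · obtain rfl := le_antisymm ht h1
    rw [h.finish, add_sub_cancel_left, one_smul]
  · rfl

lemma H_of_le (h : K.IsRootStep i f g t₀ t₁ n) (ht : t ≤ t₀) : K.H i g t = K.H i f t := by
  rw [H, h.eq_of_le ht, H]

lemma H_of_mid (h : K.IsRootStep i f g t₀ t₁ n) (ht : t₀ ≤ t) (ht' : t ≤ t₁) :
    K.H i g t = 2 * (n + 1) - K.H i f t := by
  rw [H, h.eq_of_mid ht ht', map_add, map_smul, coroot_root_self, H, smul_eq_mul]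
  ring

lemma H_of_ge (h : K.IsRootStep i f g t₀ t₁ n) (ht : t₁ ≤ t) :
    K.H i g t = K.H i f t + 2 := by
  rw [H, h.eq_of_ge ht, map_add, coroot_root_self, H]

lemma gt_of_lt (h : K.IsRootStep i f g t₀ t₁ n) (ht : 0 ≤ t) (ht' : t < t₁) :
    n < K.H i f t := by
  rcases le_or_gt t t₀ with h1 | h1
  · linarith [h.left t ht h1]
  · exact (h.mid t h1 ht').1

lemma ge (h : K.IsRootStep i f g t₀ t₁ n) (ht : 0 ≤ t) (ht' : t ≤ 1) : n ≤ K.H i f t := by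
  rcases lt_or_ge t t₁ with h1 | h1
  · exact (h.gt_of_lt ht h1).le
  · exact h.right t h1 ht'

lemma lt_target (h : K.IsRootStep i f g t₀ t₁ n) (ht : t₀ < t) (ht' : t ≤ 1) :
    n + 1 < K.H i g t := by
  rcases lt_or_ge t t₁ with h1 | h1
  · rw [h.H_of_mid ht.le h1.le]
    linarith [(h.mid t ht h1).2]
  · rw [h.H_of_ge h1]
    linarith [h.right t h1 ht']

lemma ge_target (h : K.IsRootStep i f g t₀ t₁ n) (ht : 0 ≤ t) (ht' : t ≤ 1) :
    n + 1 ≤ K.H i g t := by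
  rcases le_or_gt t t₀ with h1 | h1
  · rw [h.H_of_le h1]
    exact h.left t ht h1
  · exact (h.lt_target h1 ht').le

lemma mval_eq (h : K.IsRootStep i f g t₀ t₁ n) : K.mval i f = n := by
  refine IsLeast.csInf_eq ⟨⟨t₁, ⟨h.zero_le.trans h.lt.le, h.le_one⟩, h.finish⟩, ?_⟩
  rintro _ ⟨t, ⟨h1, h2⟩, rfl⟩
  exact h.ge h1 h2

lemma mval_target_eq (h : K.IsRootStep i f g t₀ t₁ n) : K.mval i g = n + 1 := by
  refine IsLeast.csInf_eq ⟨⟨t₀, ⟨h.zero_le, h.lt.le.trans h.le_one⟩, ?_⟩, ?_⟩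
  · rw [h.H_of_le le_rfl, h.start]
  · rintro _ ⟨t, ⟨h1, h2⟩, rfl⟩
    exact h.ge_target h1 h2

lemma eraw_eq (h : K.IsRootStep i f g t₀ t₁ n) : K.eraw i f = g := by
  have h1 : sInf {t | t ∈ Set.Icc (0 : ℝ) 1 ∧ K.H i f t = K.mval i f} = t₁ := by
    rw [h.mval_eq]
    refine IsLeast.csInf_eq ⟨⟨⟨h.zero_le.trans h.lt.le, h.le_one⟩, h.finish⟩, ?_⟩
    rintro t ⟨⟨ht, -⟩, htn⟩
    by_contra! hlt
    exact (h.gt_of_lt ht hlt).ne' htn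
  have h0 : sSup {t | t ∈ Set.Icc (0 : ℝ) t₁ ∧ K.H i f t = K.mval i f + 1} = t₀ := by
    rw [h.mval_eq]
    refine IsGreatest.csSup_eq ⟨⟨⟨h.zero_le, h.lt.le⟩, h.start⟩, ?_⟩
    rintro t ⟨⟨-, ht⟩, htn⟩
    by_contra! hlt
    rcases ht.lt_or_eq with ht | rfl
    · exact (h.mid t hlt ht).2.ne htn
    · linarith [h.finish]
  funext t
  simp only [eraw, h1, h0]
  rw [h.eq_ite]
  split_ifs
  · rfl
  · rw [refl_apply, map_sub]
    have hs : K.coroot i (f t₀) = n + 1 := h.start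
    rw [hs, H]
    module
  · rfl

lemma fraw_eq (h : K.IsRootStep i f g t₀ t₁ n) : K.fraw i g = f := by
  have h0 : sSup {t | t ∈ Set.Icc (0 : ℝ) 1 ∧ K.H i g t = K.mval i g} = t₀ := by
    rw [h.mval_target_eq]
    refine IsGreatest.csSup_eq
      ⟨⟨⟨h.zero_le, h.lt.le.trans h.le_one⟩, by rw [h.H_of_le le_rfl, h.start]⟩, ?_⟩
    rintro t ⟨⟨-, ht⟩, htn⟩
    by_contra! hlt
    exact (h.lt_target hlt ht).ne' htn
  have h1 : sInf {t | t ∈ Set.Icc t₀ 1 ∧ K.H i g t = K.mval i g + 1} = t₁ := by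
    rw [h.mval_target_eq]
    refine IsLeast.csInf_eq
      ⟨⟨⟨h.lt.le, h.le_one⟩, by rw [h.H_of_ge le_rfl, h.finish]; ring⟩, ?_⟩
    rintro t ⟨⟨ht, -⟩, htn⟩
    by_contra! hlt
    rw [h.H_of_mid ht hlt.le] at htn
    have := h.gt_of_lt (h.zero_le.trans ht) hlt
    linarith
  funext t
  simp only [fraw, h1, h0]
  split_ifs with h2 h3
  · exact h.eq_of_le h2
  · have hs : K.coroot i (f t₀) = n + 1 := h.start
    rw [h.eq_of_le le_rfl, h.eq_of_mid (not_le.1 h2).le h3, refl_apply, map_sub, map_add,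
      map_smul, coroot_root_self, hs, H, smul_eq_mul]
    module
  · rw [h.eq_of_ge (not_le.1 h3).le, add_sub_cancel_right]

lemma eop_eq (h : K.IsRootStep i f g t₀ t₁ n) (hf : f 0 = 0) : K.eop i f = some g := by
  have h0 : (n : ℝ) + 1 ≤ 0 := by
    have := h.left 0 le_rfl h.zero_le
    rwa [H, hf, map_zero] at this
  rw [eop, h.mval_eq, if_neg (by linarith), h.eraw_eq]

lemma fop_eq (h : K.IsRootStep i f g t₀ t₁ n) : K.fop i g = some f := by
  have h1 := h.right 1 h.le_one le_rfl
  rw [fop, h.mval_target_eq, h.H_of_ge h.le_one, if_neg (by linarith), h.fraw_eq]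

lemma continuous_iff (h : K.IsRootStep i f g t₀ t₁ n) :
    Continuous (K.H i f) ↔ Continuous (K.H i g) := by
  constructor
  · intro hc
    have : K.H i g = fun t => if t ≤ t₀ then K.H i f t
        else if t ≤ t₁ then 2 * (n + 1) - K.H i f t else K.H i f t + 2 := by
      funext t
      split_ifs with h1 h2
      · exact h.H_of_le h1
      · exact h.H_of_mid (not_le.1 h1).le h2
      · exact h.H_of_ge (not_le.1 h2).le
    rw [this]
    refine Continuous.if_le hc (Continuous.if_le (by fun_prop) (by fun_prop) continuous_id
      continuous_const ?_) continuous_id continuous_const ?_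
    · rintro _ rfl
      rw [h.finish]
      ring
    · rintro _ rfl
      rw [if_pos h.lt.le, h.start]
      ring
  · intro hc
    have : K.H i f = fun t => if t ≤ t₀ then K.H i g t
        else if t ≤ t₁ then 2 * (n + 1) - K.H i g t else K.H i g t - 2 := by
      funext t
      split_ifs with h1 h2
      · exact (h.H_of_le h1).symm
      · rw [h.H_of_mid (not_le.1 h1).le h2]
        ring
      · rw [h.H_of_ge (not_le.1 h2).le]
        ring
    rw [this]
    refine Continuous.if_le hc (Continuous.if_le (by fun_prop) (by fun_prop) continuous_id
      continuous_const ?_) continuous_id continuous_const ?_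
    · rintro _ rfl
      rw [h.H_of_ge le_rfl, h.finish]
      ring
    · rintro _ rfl
      rw [if_pos h.lt.le, h.H_of_le le_rfl, h.start]
      ring

theorem isIntegralPath_target (h : K.IsRootStep i f g t₀ t₁ n) (hf : K.IsIntegralPath i f) :
    K.IsIntegralPath i g where
  eq_zero t ht := by rw [h.eq_of_le (ht.trans h.zero_le), hf.eq_zero t ht]
  eq_one t ht := by rw [h.eq_of_ge (h.le_one.trans ht), h.eq_of_ge h.le_one, hf.eq_one t ht]
  continuous := h.continuous_iff.1 hf.continuous
  int_one := by
    obtain ⟨k, hk⟩ := hf.int_one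
    exact ⟨k + 2, by rw [h.H_of_ge h.le_one, hk]; push_cast; rfl⟩
  valley a b c k ha hab hbc hc hb hka hkc := by
    have hnk : n + 1 ≤ k := by
      have : ((n + 1 : ℤ) : ℝ) < ((k + 1 : ℤ) : ℝ) := by
        push_cast
        exact (h.ge_target (ha.trans hab) (hbc.trans hc)).trans_lt hb
      have : n + 1 < k + 1 := by exact_mod_cast this
      omega
    have hnk' : (n : ℝ) + 1 ≤ k := by exact_mod_cast hnk
    rcases lt_or_ge c t₀ with hct | hct
    · rw [h.H_of_le (by linarith)] at hb hka hkc
      obtain ⟨x, h1, h2, h3⟩ := hf.valley a b c k ha hab hbc hc hb hka hkc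
      exact ⟨x, h1, h2, by rwa [h.H_of_le (by linarith)]⟩
    rcases le_or_gt a t₀ with hat | hat
    · exact ⟨t₀, hat, hct, by rwa [h.H_of_le le_rfl, h.start]⟩
    rcases lt_or_ge a t₁ with hat' | hat'
    · rw [h.H_of_mid hat.le hat'.le] at hka
      linarith [(h.mid a hat hat').1]
    · rw [h.H_of_ge (by linarith)] at hb hka hkc
      obtain ⟨x, h1, h2, h3⟩ := hf.valley a b c (k - 2) ha hab hbc hc (by push_cast; linarith)
        (by push_cast; linarith) (by push_cast; linarith)
      refine ⟨x, h1, h2, ?_⟩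
      push_cast at h3
      rw [h.H_of_ge (by linarith)]
      linarith

theorem isIntegralPath_source (h : K.IsRootStep i f g t₀ t₁ n) (hg : K.IsIntegralPath i g) :
    K.IsIntegralPath i f where
  eq_zero t ht := by rw [← h.eq_of_le (ht.trans h.zero_le), hg.eq_zero t ht]
  eq_one t ht := by
    have := hg.eq_one t ht
    rwa [h.eq_of_ge (h.le_one.trans ht), h.eq_of_ge h.le_one, add_left_inj] at this
  continuous := h.continuous_iff.2 hg.continuous
  int_one := by
    obtain ⟨k, hk⟩ := hg.int_one
    rw [h.H_of_ge h.le_one] at hk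
    exact ⟨k - 2, by push_cast; linarith⟩
  valley a b c k ha hab hbc hc hb hka hkc := by
    have hnk : n ≤ k := by
      have : (n : ℝ) < ((k + 1 : ℤ) : ℝ) := by
        push_cast
        exact (h.ge (ha.trans hab) (hbc.trans hc)).trans_lt hb
      have : n < k + 1 := by exact_mod_cast this
      omega
    have hnk' : (n : ℝ) ≤ k := by exact_mod_cast hnk
    rcases lt_or_ge t₁ a with hat | hat
    · have e : ∀ x, a ≤ x → K.H i f x = K.H i g x - 2 := fun x hx => by
        rw [h.H_of_ge (by linarith)]
        ring
      rw [e _ (by linarith)] at hb hka hkc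
      obtain ⟨x, h1, h2, h3⟩ := hg.valley a b c (k + 2) ha hab hbc hc (by push_cast; linarith)
        (by push_cast; linarith) (by push_cast; linarith)
      refine ⟨x, h1, h2, ?_⟩
      push_cast at h3
      rw [e x h1]
      linarith
    rcases le_or_gt t₁ c with hct | hct
    · exact ⟨t₁, hat, hct, by rwa [h.finish]⟩
    rcases lt_or_ge t₀ c with hct' | hct'
    · linarith [(h.mid c hct' hct).2]
    · rw [← h.H_of_le (by linarith)] at hb hka hkc
      obtain ⟨x, h1, h2, h3⟩ := hg.valley a b c k ha hab hbc hc hb hka hkc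
      exact ⟨x, h1, h2, by rwa [← h.H_of_le (by linarith)]⟩

end IsRootStep

namespace IsIntegralPath

variable {K : KacMoodyData I V} {i : I} {f g : ℝ → V}

lemma H_zero (hf : K.IsIntegralPath i f) : K.H i f 0 = 0 := by
  rw [H, hf.eq_zero 0 le_rfl, map_zero]

lemma exists_min (hf : K.IsIntegralPath i f) : ∃ n : ℤ, K.mval i f = n ∧
    (∃ x, 0 ≤ x ∧ x ≤ 1 ∧ K.H i f x = n) ∧ ∀ t, 0 ≤ t → t ≤ 1 → n ≤ K.H i f t := by
  obtain ⟨x, hx, hmin⟩ := (isCompact_Icc (a := (0 : ℝ)) (b := 1)).exists_isMinOn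
    ⟨0, le_rfl, zero_le_one⟩ hf.continuous.continuousOn
  have hmin' : ∀ t, 0 ≤ t → t ≤ 1 → K.H i f x ≤ K.H i f t := fun t h1 h2 => hmin ⟨h1, h2⟩
  have hm : K.mval i f = K.H i f x := by
    refine IsLeast.csInf_eq ⟨⟨x, hx, rfl⟩, ?_⟩
    rintro _ ⟨t, ht, rfl⟩
    exact hmin ht
  have key : K.H i f x = (⌊K.H i f x⌋ : ℝ) := by
    by_contra hne
    have hlt : (⌊K.H i f x⌋ : ℝ) < K.H i f x := lt_of_le_of_ne (Int.floor_le _) (Ne.symm hne)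
    have hends : ∀ k : ℤ, K.H i f x ≤ k → (⌊K.H i f x⌋ : ℝ) + 1 ≤ k := fun k hk => by
      have : ⌊K.H i f x⌋ < k := by exact_mod_cast hlt.trans_le hk
      exact_mod_cast this
    obtain ⟨k, hk⟩ := hf.int_one
    obtain ⟨y, h1, h2, h3⟩ := hf.valley 0 x 1 ⌊K.H i f x⌋ le_rfl hx.1 hx.2 le_rfl
      (Int.lt_floor_add_one _)
      (by
        have := hends 0 (by push_cast; exact hf.H_zero ▸ hmin' 0 le_rfl zero_le_one)
        rw [hf.H_zero]
        exact_mod_cast this)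
      (hk ▸ hends k (hk ▸ hmin' 1 zero_le_one le_rfl))
    linarith [hmin' y h1 h2]
  exact ⟨⌊K.H i f x⌋, hm.trans key, ⟨x, hx.1, hx.2, key⟩,
    fun t h1 h2 => key ▸ hmin' t h1 h2⟩

lemma mval_le (hf : K.IsIntegralPath i f) {t : ℝ} (ht : 0 ≤ t) (ht' : t ≤ 1) :
    K.mval i f ≤ K.H i f t := by
  obtain ⟨n, hn, -, hmin⟩ := hf.exists_min
  exact hn ▸ hmin t ht ht'

lemma mval_nonpos (hf : K.IsIntegralPath i f) : K.mval i f ≤ 0 :=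
  hf.H_zero ▸ hf.mval_le le_rfl zero_le_one

theorem exists_raise (hf : K.IsIntegralPath i f) (hne : K.mval i f ≠ 0) :
    ∃ g t₀ t₁ n, K.IsRootStep i f g t₀ t₁ n := by
  obtain ⟨n, hn, ⟨y, hy0, hy1, hy⟩, hmin⟩ := hf.exists_min
  have hn1 : n + 1 ≤ 0 := by
    have h1 : (n : ℝ) ≤ (0 : ℤ) := by
      push_cast
      exact hn ▸ hf.mval_nonpos
    have h2 : n ≠ 0 := fun h => hne (by rw [hn, h, Int.cast_zero])
    have h1 : n ≤ 0 := by exact_mod_cast h1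
    omega
  have hn1' : (n : ℝ) + 1 ≤ 0 := by exact_mod_cast hn1
  have hc := hf.continuous
  let S : Set ℝ := Set.Icc 0 1 ∩ K.H i f ⁻¹' {(n : ℝ)}
  have hS : IsClosed S := isClosed_Icc.inter (isClosed_singleton.preimage hc)
  have hSb : BddBelow S := ⟨0, fun x hx => hx.1.1⟩
  obtain ⟨⟨ht0, ht1⟩, ht⟩ : sInf S ∈ S := hS.csInf_mem ⟨y, ⟨hy0, hy1⟩, hy⟩ hSb
  have hfirst : ∀ x, 0 ≤ x → x ≤ 1 → K.H i f x ≤ n → sInf S ≤ x := fun x h1 h2 h3 =>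
    csInf_le hSb ⟨⟨h1, h2⟩, le_antisymm h3 (hmin x h1 h2)⟩
  generalize sInf S = t₁ at ht0 ht1 ht hfirst
  have ht : K.H i f t₁ = n := ht
  let T : Set ℝ := Set.Icc 0 t₁ ∩ K.H i f ⁻¹' {(n : ℝ) + 1}
  have hT : IsClosed T := isClosed_Icc.inter (isClosed_singleton.preimage hc)
  have hTb : BddAbove T := ⟨t₁, fun x hx => hx.1.2⟩
  have hTne : T.Nonempty := by
    obtain ⟨x, hx, hx'⟩ := intermediate_value_Icc' ht0 hc.continuousOn
      (show (n : ℝ) + 1 ∈ Set.Icc (K.H i f t₁) (K.H i f 0) by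
        rw [ht, hf.H_zero]
        exact ⟨by linarith, hn1'⟩)
    exact ⟨x, hx, hx'⟩
  obtain ⟨⟨hs0, hs1⟩, hs⟩ : sSup T ∈ T := hT.csSup_mem hTne hTb
  have hlast : ∀ x, 0 ≤ x → x ≤ t₁ → K.H i f x = n + 1 → x ≤ sSup T := fun x h1 h2 h3 =>
    le_csSup hTb ⟨⟨h1, h2⟩, h3⟩
  generalize sSup T = t₀ at hs0 hs1 hs hlast
  have hs : K.H i f t₀ = n + 1 := hs
  have hlt : t₀ < t₁ := lt_of_le_of_ne hs1 fun h => by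
    rw [h, ht] at hs
    linarith
  refine ⟨_, t₀, t₁, n, hs0, hlt, ht1, hs, ht, fun t h1 h2 => ?_, fun t h1 h2 => ⟨?_, ?_⟩,
    fun t h1 h2 => hmin t (by linarith) h2, fun t => rfl⟩
  · by_contra! hlow
    obtain ⟨x, hx0, hx1, hx⟩ := hf.valley 0 t t₀ n le_rfl h1 h2 (by linarith) hlow
      (by rwa [hf.H_zero]) hs.ge
    linarith [hfirst x hx0 (by linarith) hx]
  · by_contra! hle
    linarith [hfirst t (by linarith) (by linarith) hle]
  · by_contra! hge
    obtain ⟨x, hx, hx'⟩ := intermediate_value_Icc' h2.le hc.continuousOn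
      (show (n : ℝ) + 1 ∈ Set.Icc (K.H i f t₁) (K.H i f t) by
        rw [ht]
        exact ⟨by linarith, hge⟩)
    linarith [hlast x (by linarith [hx.1]) hx.2 hx', hx.1]

theorem exists_lower (hg : K.IsIntegralPath i g) (hne : K.H i g 1 ≠ K.mval i g) :
    ∃ f t₀ t₁ n, K.IsRootStep i f g t₀ t₁ n := by
  obtain ⟨m, hm, ⟨y, hy0, hy1, hy⟩, hmin⟩ := hg.exists_min
  obtain ⟨k, hk⟩ := hg.int_one
  have hmk : m + 1 ≤ k := by
    have h1 : (m : ℝ) ≤ k := hk ▸ hmin 1 zero_le_one le_rfl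
    have h2 : m ≠ k := fun h => hne (by rw [hm, h, hk])
    have h1 : m ≤ k := by exact_mod_cast h1
    omega
  have hmk' : (m : ℝ) + 1 ≤ K.H i g 1 := by
    rw [hk]
    exact_mod_cast hmk
  have hc := hg.continuous
  let S : Set ℝ := Set.Icc 0 1 ∩ K.H i g ⁻¹' {(m : ℝ)}
  have hS : IsClosed S := isClosed_Icc.inter (isClosed_singleton.preimage hc)
  have hSb : BddAbove S := ⟨1, fun x hx => hx.1.2⟩
  obtain ⟨⟨ht0, ht1⟩, ht⟩ : sSup S ∈ S := hS.csSup_mem ⟨y, ⟨hy0, hy1⟩, hy⟩ hSb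
  have hlast : ∀ x, 0 ≤ x → x ≤ 1 → K.H i g x ≤ m → x ≤ sSup S := fun x h1 h2 h3 =>
    le_csSup hSb ⟨⟨h1, h2⟩, le_antisymm h3 (hmin x h1 h2)⟩
  generalize sSup S = t₀ at ht0 ht1 ht hlast
  have ht : K.H i g t₀ = m := ht
  let T : Set ℝ := Set.Icc t₀ 1 ∩ K.H i g ⁻¹' {(m : ℝ) + 1}
  have hT : IsClosed T := isClosed_Icc.inter (isClosed_singleton.preimage hc)
  have hTb : BddBelow T := ⟨t₀, fun x hx => hx.1.1⟩
  have hTne : T.Nonempty := by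
    obtain ⟨x, hx, hx'⟩ := intermediate_value_Icc ht1 hc.continuousOn
      (show (m : ℝ) + 1 ∈ Set.Icc (K.H i g t₀) (K.H i g 1) by
        rw [ht]
        exact ⟨by linarith, hmk'⟩)
    exact ⟨x, hx, hx'⟩
  obtain ⟨⟨hs0, hs1⟩, hs⟩ : sInf T ∈ T := hT.csInf_mem hTne hTb
  have hfirst : ∀ x, t₀ ≤ x → x ≤ 1 → K.H i g x = m + 1 → sInf T ≤ x := fun x h1 h2 h3 =>
    csInf_le hTb ⟨⟨h1, h2⟩, h3⟩
  generalize sInf T = t₁ at hs0 hs1 hs hfirst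
  have hs : K.H i g t₁ = m + 1 := hs
  have hlt : t₀ < t₁ := lt_of_le_of_ne hs0 fun h => by
    rw [← h, ht] at hs
    linarith
  have hmid : ∀ t, t₀ < t → t < t₁ → m < K.H i g t ∧ K.H i g t < m + 1 := by
    refine fun t h1 h2 => ⟨?_, ?_⟩
    · by_contra! hle
      linarith [hlast t (by linarith) (by linarith) hle]
    · by_contra! hge
      obtain ⟨x, hx, hx'⟩ := intermediate_value_Icc h1.le hc.continuousOn
        (show (m : ℝ) + 1 ∈ Set.Icc (K.H i g t₀) (K.H i g t) by
          rw [ht]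
          exact ⟨by linarith, hge⟩)
      linarith [hfirst x hx.1 (by linarith [hx.2]) hx', hx.2]
  have hright : ∀ t, t₁ ≤ t → t ≤ 1 → (m : ℝ) + 1 ≤ K.H i g t := by
    intro t h1 h2
    by_contra! hlow
    obtain ⟨x, hx0, hx1, hx⟩ := hg.valley t₁ t 1 m (by linarith) h1 h2 le_rfl hlow hs.ge hmk'
    linarith [hlast x (by linarith) (by linarith) hx]
  let f : ℝ → V := fun t => if t ≤ t₀ then g t
    else if t ≤ t₁ then g t - (K.H i g t - m) • K.α i else g t - K.α i
  have hleft : ∀ t, t ≤ t₀ → f t = g t := fun t h => if_pos h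
  have hmidf : ∀ t, t₀ < t → t ≤ t₁ → f t = g t - (K.H i g t - m) • K.α i := fun t h h' => by
    simp only [f, if_neg (not_le.2 h), if_pos h']
  have hrightf : ∀ t, t₁ < t → f t = g t - K.α i := fun t h => by
    simp only [f, if_neg (not_le.2 (hlt.trans h)), if_neg (not_le.2 h)]
  have hleftH : ∀ t, t ≤ t₀ → K.H i f t = K.H i g t := fun t h => by rw [H, hleft t h, H]
  have hmidH : ∀ t, t₀ < t → t ≤ t₁ → K.H i f t = 2 * m - K.H i g t := fun t h h' => by
    rw [H, hmidf t h h', map_sub, map_smul, coroot_root_self, smul_eq_mul, H]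
    ring
  have hrightH : ∀ t, t₁ < t → K.H i f t = K.H i g t - 2 := fun t h => by
    rw [H, hrightf t h, map_sub, coroot_root_self, H]
  refine ⟨f, t₀, t₁, m - 1, ht0, hlt, hs1, ?_, ?_, fun t h1 h2 => ?_, fun t h1 h2 => ?_,
    fun t h1 h2 => ?_, fun t => ?_⟩
  · rw [hleftH _ le_rfl, ht]
    push_cast
    ring
  · rw [hmidH _ hlt le_rfl, hs]
    push_cast
    ring
  · rw [hleftH t h2]
    push_cast
    linarith [hmin t h1 (by linarith)]
  · rw [hmidH t h1 h2.le]
    push_cast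
    constructor <;> linarith [hmid t h1 h2]
  · push_cast
    rcases h1.eq_or_lt with rfl | h1
    · rw [hmidH _ hlt le_rfl]
      linarith
    · rw [hrightH t h1]
      linarith [hright t h1.le h2]
  · split_ifs with h1 h2
    · exact (hleft t h1).symm
    · rw [hmidH t (not_le.1 h1) h2, hmidf t (not_le.1 h1) h2]
      push_cast
      module
    · rw [hrightf t (not_le.1 h2), sub_add_cancel]

lemma exists_of_eop (hf : K.IsIntegralPath i f) (h : K.eop i f = some g) :
    ∃ t₀ t₁ n, K.IsRootStep i f g t₀ t₁ n := by
  have hne : K.mval i f ≠ 0 := fun h0 => by simp [eop, h0] at h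
  obtain ⟨g', t₀, t₁, n, hs⟩ := hf.exists_raise hne
  rw [hs.eop_eq (hf.eq_zero 0 le_rfl), Option.some_inj] at h
  exact ⟨t₀, t₁, n, h ▸ hs⟩

lemma exists_of_fop (hg : K.IsIntegralPath i g) (h : K.fop i g = some f) :
    ∃ t₀ t₁ n, K.IsRootStep i f g t₀ t₁ n := by
  have hne : K.H i g 1 ≠ K.mval i g := fun h0 => by simp [fop, h0] at h
  obtain ⟨f', t₀, t₁, n, hs⟩ := hg.exists_lower hne
  rw [hs.fop_eq, Option.some_inj] at h
  exact ⟨t₀, t₁, n, h ▸ hs⟩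

end IsIntegralPath

section StringLength

variable {K : KacMoodyData I V} {i : I} {f g : ℝ → V}

lemma iterate_bind_none {α : Type*} (F : α → Option α) (n : ℕ) :
    (fun o : Option α => o.bind F)^[n] none = none := by
  induction n with
  | zero => rfl
  | succ n ih => rw [Function.iterate_succ_apply, Option.bind_none, ih]

lemma IsIntegralPath.eIter_ne_none_iff (hf : K.IsIntegralPath i f) {k : ℕ}
    (hk : K.mval i f = -k) (n : ℕ) : K.eIter i n f ≠ none ↔ n ≤ k := by
  induction n generalizing f k with
  | zero => simp [eIter]
  | succ n ih =>
    rw [eIter, Function.iterate_succ_apply, Option.bind_some]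
    rcases k with _ | k
    · rw [eop, if_pos (by simpa using hk), iterate_bind_none]
      simp
    · obtain ⟨g, t₀, t₁, m, hs⟩ := hf.exists_raise
        (by rw [hk]; push_cast; linarith [k.cast_nonneg (α := ℝ)])
      rw [hs.eop_eq (hf.eq_zero 0 le_rfl), Nat.succ_le_succ_iff]
      refine ih (hs.isIntegralPath_target hf) ?_
      rw [hs.mval_target_eq, ← hs.mval_eq, hk]
      push_cast
      ring

lemma IsIntegralPath.fIter_ne_none_iff (hf : K.IsIntegralPath i f) {k : ℕ}
    (hk : K.H i f 1 - K.mval i f = k) (n : ℕ) : K.fIter i n f ≠ none ↔ n ≤ k := by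
  induction n generalizing f k with
  | zero => simp [fIter]
  | succ n ih =>
    rw [fIter, Function.iterate_succ_apply, Option.bind_some]
    rcases k with _ | k
    · rw [fop, if_pos (by simpa using hk), iterate_bind_none]
      simp
    · obtain ⟨g, t₀, t₁, m, hs⟩ := hf.exists_lower fun h => by
        rw [h, sub_self] at hk
        push_cast at hk
        linarith [k.cast_nonneg (α := ℝ)]
      rw [hs.fop_eq, Nat.succ_le_succ_iff]
      refine ih (hs.isIntegralPath_source hf) ?_
      rw [hs.mval_target_eq, hs.H_of_ge hs.le_one] at hk
      rw [hs.mval_eq]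
      push_cast at hk
      linarith

theorem IsIntegralPath.epsilon_eq (hf : K.IsIntegralPath i f) :
    (K.epsilon i f : ℝ) = -K.mval i f := by
  obtain ⟨n, hn, -⟩ := hf.exists_min
  have hn0 : n ≤ 0 := by exact_mod_cast hn ▸ hf.mval_nonpos
  obtain ⟨k, rfl⟩ : ∃ k : ℕ, n = -k := ⟨(-n).toNat, by omega⟩
  push_cast at hn
  have hset : {n | K.eIter i n f ≠ none} = Set.Iic k :=
    Set.ext fun n => hf.eIter_ne_none_iff hn n
  rw [epsilon, hset, csSup_Iic, hn, neg_neg]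

theorem IsIntegralPath.phi_eq (hf : K.IsIntegralPath i f) :
    (K.phi i f : ℝ) = K.H i f 1 - K.mval i f := by
  obtain ⟨n, hn, -, hmin⟩ := hf.exists_min
  obtain ⟨p, hp⟩ := hf.int_one
  have hnp : n ≤ p := by exact_mod_cast hp ▸ hmin 1 zero_le_one le_rfl
  obtain ⟨k, rfl⟩ : ∃ k : ℕ, p = n + k := ⟨(p - n).toNat, by omega⟩
  have hk : K.H i f 1 - K.mval i f = k := by
    rw [hn, hp]
    push_cast
    ring
  have hset : {n | K.fIter i n f ≠ none} = Set.Iic k :=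
    Set.ext fun n => hf.fIter_ne_none_iff hk n
  rw [phi, hset, csSup_Iic, hk]

end StringLength

end RootStep

end KacMoodyData
end LSPaper

namespace LSPaper

section Cat

variable {V : Type*} [AddCommGroup V]

/-- The concatenation of `f`, traversed on `[0, s]`, and `g`, traversed on `[s, 1]`. -/
def cat (s : ℝ) (f g : ℝ → V) : ℝ → V := fun t =>
  if t ≤ s then f (t / s) else f 1 + g ((t - s) / (1 - s))

variable {s u : ℝ} {f g : ℝ → V}

lemma cat_left (hs : 0 < s) (hu : u ≤ 1) : cat s f g (s * u) = f u := by
  rw [cat, if_pos (by nlinarith), mul_div_cancel_left₀ _ hs.ne']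

lemma cat_right (hs : 0 < s) (hs1 : s < 1) (hg : g 0 = 0) (hu : 0 ≤ u) :
    cat s f g (s + (1 - s) * u) = f 1 + g u := by
  have hs1 : 0 < 1 - s := by linarith
  rcases hu.eq_or_lt with rfl | hu
  · rw [mul_zero, add_zero, hg, add_zero]
    simpa using cat_left (s := s) (f := f) (g := g) hs le_rfl
  · rw [cat, if_neg (by have := mul_pos hs1 hu; linarith), add_sub_cancel_left,
      mul_div_cancel_left₀ _ hs1.ne']

lemma cat_one (hs : 0 < s) (hs1 : s < 1) (hg : g 0 = 0) : cat s f g 1 = f 1 + g 1 := by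
  have := cat_right (f := f) hs hs1 hg zero_le_one
  rwa [mul_one, add_sub_cancel] at this

/-- A point of `(-∞, s]` or of `(s, ∞)`, in the parameter of the corresponding half. -/
lemma exists_param (hs : 0 < s) (hs1 : s < 1) (t : ℝ) :
    (∃ u ≤ 1, t = s * u) ∨ ∃ u, 0 < u ∧ t = s + (1 - s) * u := by
  have hs1 : 0 < 1 - s := by linarith
  rcases le_or_gt t s with h | h
  · exact Or.inl ⟨t / s, (div_le_one hs).2 h, by field_simp⟩
  · refine Or.inr ⟨(t - s) / (1 - s), div_pos (by linarith) hs1, ?_⟩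
    rw [mul_div_cancel₀ _ hs1.ne']
    ring

lemma concatList_singleton (b : ℝ → V) : concatList [b] = b := by
  funext t
  simp [concatList]

lemma concatList_cons_cons (b c : ℝ → V) (rest : List (ℝ → V)) :
    concatList (b :: c :: rest) =
      cat (1 / ((rest.length : ℝ) + 2)) b (concatList (c :: rest)) := by
  funext t
  set n := rest.length with hn
  have hpos : (0 : ℝ) < (n : ℝ) + 2 := by positivity
  have hpos' : (0 : ℝ) < (n : ℝ) + 1 := by positivity
  have hcond : t ≤ 1 / ((n : ℝ) + 2) ↔ ((n : ℝ) + 2) * t ≤ 1 := by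
    rw [le_div_iff₀ hpos, mul_comm]
  have hlen : (((b :: c :: rest).length : ℕ) : ℝ) = (n : ℝ) + 2 := by
    simp only [List.length_cons, ← hn]
    push_cast
    ring
  have hlen' : (((c :: rest).length : ℕ) : ℝ) = (n : ℝ) + 1 := by
    simp only [List.length_cons, ← hn]
    push_cast
    ring
  rw [cat]
  split_ifs with h
  · rw [hcond] at h
    have hc : ⌈((n : ℝ) + 2) * t⌉ ≤ 1 := Int.ceil_le.2 (by exact_mod_cast h)
    have hk : max 1 (min (b :: c :: rest).length ⌈((n : ℝ) + 2) * t⌉.toNat) = 1 := by omega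
    simp only [concatList, hlen, hk]
    simp [mul_comm]
  · rw [hcond, not_le] at h
    have harg : ((n : ℝ) + 1) * ((t - 1 / ((n : ℝ) + 2)) / (1 - 1 / ((n : ℝ) + 2))) =
        ((n : ℝ) + 2) * t - 1 := by
      have : 1 - 1 / ((n : ℝ) + 2) = ((n : ℝ) + 1) / ((n : ℝ) + 2) := by
        field_simp
        ring
      rw [this]
      field_simp
    have hc : 1 < ⌈((n : ℝ) + 2) * t⌉ := Int.lt_ceil.2 (by exact_mod_cast h)
    have hc' : ⌈((n : ℝ) + 2) * t - 1⌉ = ⌈((n : ℝ) + 2) * t⌉ - 1 := Int.ceil_sub_one _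
    obtain ⟨j, hj, hj'⟩ : ∃ j : ℕ,
        max 1 (min (b :: c :: rest).length ⌈((n : ℝ) + 2) * t⌉.toNat) = j + 2 ∧
        max 1 (min (c :: rest).length ⌈((n : ℝ) + 2) * t - 1⌉.toNat) = j + 1 := by
      rw [hc']
      simp only [List.length_cons]
      exact ⟨min n (⌈((n : ℝ) + 2) * t⌉.toNat - 2), by omega, by omega⟩
    simp only [concatList, hlen, hlen', harg, hj, hj']
    have e : ((n : ℝ) + 2) * t - (((j + 2 : ℕ) : ℝ) - 1) =
        ((n : ℝ) + 2) * t - 1 - (((j + 1 : ℕ) : ℝ) - 1) := by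
      push_cast
      ring
    rw [e]
    simp [add_assoc]

lemma concatList_cons (b : ℝ → V) {l : List (ℝ → V)} {n : ℕ} (hl : l.length = n + 1) :
    concatList (b :: l) = cat (1 / ((n : ℝ) + 2)) b (concatList l) := by
  rcases l with _ | ⟨c, rest⟩
  · simp at hl
  · rw [List.length_cons, Nat.add_right_cancel_iff] at hl
    rw [concatList_cons_cons, hl]

end Cat

namespace KacMoodyData

section Cat

variable {I V : Type*} [Fintype I] [DecidableEq I] [AddCommGroup V] [Module ℝ V]
variable {K : KacMoodyData I V} {i : I} {s u : ℝ} {f f' g g' : ℝ → V}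

lemma H_cat_left (hs : 0 < s) (hu : u ≤ 1) : K.H i (cat s f g) (s * u) = K.H i f u := by
  rw [H, cat_left hs hu, H]

lemma H_cat_right (hs : 0 < s) (hs1 : s < 1) (hg : g 0 = 0) (hu : 0 ≤ u) :
    K.H i (cat s f g) (s + (1 - s) * u) = K.H i f 1 + K.H i g u := by
  rw [H, cat_right hs hs1 hg hu, map_add, H, H]

lemma H_cat_one (hs : 0 < s) (hs1 : s < 1) (hg : g 0 = 0) :
    K.H i (cat s f g) 1 = K.H i f 1 + K.H i g 1 := by
  rw [H, cat_one hs hs1 hg, map_add, H, H]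

theorem IsIntegralPath.cat (hs : 0 < s) (hs1 : s < 1) (hf : K.IsIntegralPath i f)
    (hg : K.IsIntegralPath i g) : K.IsIntegralPath i (cat s f g) where
  eq_zero t ht := by
    rw [LSPaper.cat, if_pos (by linarith), hf.eq_zero _ (div_nonpos_of_nonpos_of_nonneg ht hs.le)]
  eq_one t ht := by
    rw [cat_one hs hs1 (hg.eq_zero 0 le_rfl), LSPaper.cat, if_neg (by linarith),
      hg.eq_one _ ((one_le_div (by linarith)).2 (by linarith))]
  continuous := by
    have h1 : K.H i (LSPaper.cat s f g) = fun t => if t ≤ s then K.H i f (t / s)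
        else K.H i f 1 + K.H i g ((t - s) / (1 - s)) := by
      funext t
      rw [H, LSPaper.cat]
      split_ifs <;> simp [H]
    have hcf := hf.continuous
    have hcg := hg.continuous
    rw [h1]
    refine Continuous.if_le (by fun_prop) (by fun_prop) continuous_id continuous_const ?_
    rintro _ rfl
    rw [div_self hs.ne', sub_self, zero_div, hg.H_zero, add_zero]
  int_one := by
    obtain ⟨p, hp⟩ := hf.int_one
    obtain ⟨q, hq⟩ := hg.int_one
    exact ⟨p + q, by rw [H_cat_one hs hs1 (hg.eq_zero 0 le_rfl), hp, hq]; push_cast; rfl⟩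
  valley a b c n ha hab hbc hc hb hna hnc := by
    have hg0 := hg.eq_zero 0 le_rfl
    have hs1' : 0 < 1 - s := by linarith
    obtain ⟨p, hp⟩ := hf.int_one
    have hL : ∀ a b c, 0 ≤ a → a ≤ b → b ≤ c → c ≤ 1 → K.H i f b < n + 1 →
        n + 1 ≤ K.H i f a → n + 1 ≤ K.H i f c →
        ∃ x, s * a ≤ x ∧ x ≤ s * c ∧ K.H i (LSPaper.cat s f g) x ≤ n := by
      intro a b c ha hab hbc hc hb hna hnc
      obtain ⟨x, h1, h2, h3⟩ := hf.valley a b c n ha hab hbc hc hb hna hnc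
      exact ⟨s * x, by gcongr, by gcongr, by rwa [H_cat_left hs (h2.trans hc)]⟩
    have hR : ∀ a b c, 0 ≤ a → a ≤ b → b ≤ c → c ≤ 1 → p + K.H i g b < n + 1 →
        n + 1 ≤ p + K.H i g a → n + 1 ≤ p + K.H i g c →
        ∃ x, s + (1 - s) * a ≤ x ∧ x ≤ s + (1 - s) * c ∧
          K.H i (LSPaper.cat s f g) x ≤ n := by
      intro a b c ha hab hbc hc hb hna hnc
      obtain ⟨x, h1, h2, h3⟩ := hg.valley a b c (n - p) ha hab hbc hc
        (by push_cast; linarith) (by push_cast; linarith) (by push_cast; linarith)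
      push_cast at h3
      exact ⟨s + (1 - s) * x, by gcongr, by gcongr, by
        rw [H_cat_right hs hs1 hg0 (ha.trans h1), hp]
        linarith⟩
    have hmid : K.H i (LSPaper.cat s f g) s = p := by
      have := H_cat_left (K := K) (i := i) (f := f) (g := g) hs le_rfl
      rwa [mul_one, hp] at this
    rcases lt_or_ge p (n + 1) with hpn | hpn
    · have hpn : (p : ℝ) ≤ n := by exact_mod_cast Int.lt_add_one_iff.1 hpn
      rcases exists_param hs hs1 c with ⟨c, hc1, rfl⟩ | ⟨c, hc0, rfl⟩
      · obtain ⟨b, rfl⟩ : ∃ b', b = s * b' := ⟨b / s, by field_simp⟩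
        obtain ⟨a, rfl⟩ : ∃ a', a = s * a' := ⟨a / s, by field_simp⟩
        have hab := le_of_mul_le_mul_left hab hs
        have hbc := le_of_mul_le_mul_left hbc hs
        rw [H_cat_left hs (by linarith)] at hb hna hnc
        exact hL a b c (nonneg_of_mul_nonneg_right ha hs) hab hbc hc1 hb hna hnc
      · rcases lt_or_ge s a with has | has
        · obtain ⟨a, rfl⟩ : ∃ a', a = s + (1 - s) * a' :=
            ⟨(a - s) / (1 - s), by rw [mul_div_cancel₀ _ hs1'.ne']; ring⟩
          obtain ⟨b, rfl⟩ : ∃ b', b = s + (1 - s) * b' :=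
            ⟨(b - s) / (1 - s), by rw [mul_div_cancel₀ _ hs1'.ne']; ring⟩
          have hab : a ≤ b := le_of_mul_le_mul_left (by linarith) hs1'
          have hbc : b ≤ c := le_of_mul_le_mul_left (by linarith) hs1'
          have ha : 0 < a := pos_of_mul_pos_right (a := 1 - s) (by linarith) hs1'.le
          rw [H_cat_right hs hs1 hg0 (by linarith), hp] at hb hna hnc
          exact hR a b c ha.le hab hbc
            (le_of_mul_le_mul_left (by linarith) hs1') hb hna hnc
        · exact ⟨s, has, by have := mul_pos hs1' hc0; linarith, by rwa [hmid]⟩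
    · have hpn : (n : ℝ) + 1 ≤ p := by exact_mod_cast hpn
      rcases exists_param hs hs1 b with ⟨b, hb1, rfl⟩ | ⟨b, hb0, rfl⟩
      · obtain ⟨a, rfl⟩ : ∃ a', a = s * a' := ⟨a / s, by field_simp⟩
        have hab := le_of_mul_le_mul_left hab hs
        have ha := nonneg_of_mul_nonneg_right ha hs
        rw [H_cat_left hs (by linarith)] at hb hna
        rcases exists_param hs hs1 c with ⟨c, hc1, rfl⟩ | ⟨c, hc0, rfl⟩
        · rw [H_cat_left hs hc1] at hnc
          exact hL a b c ha hab (le_of_mul_le_mul_left hbc hs) hc1 hb hna hnc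
        · obtain ⟨x, h1, h2, h3⟩ := hL a b 1 ha hab hb1 le_rfl hb hna (hp ▸ hpn)
          exact ⟨x, h1, by have := mul_pos hs1' hc0; linarith, h3⟩
      · obtain ⟨c, rfl⟩ : ∃ c', c = s + (1 - s) * c' :=
            ⟨(c - s) / (1 - s), by rw [mul_div_cancel₀ _ hs1'.ne']; ring⟩
        have hbc : b ≤ c := le_of_mul_le_mul_left (by linarith) hs1'
        have hc : c ≤ 1 := le_of_mul_le_mul_left (by linarith) hs1'
        rw [H_cat_right hs hs1 hg0 (by linarith), hp] at hb hnc
        rcases exists_param hs hs1 a with ⟨a, ha1, rfl⟩ | ⟨a, ha0, rfl⟩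
        · obtain ⟨x, h1, h2, h3⟩ := hR 0 b c le_rfl hb0.le hbc hc hb
            (by rwa [hg.H_zero, add_zero]) hnc
          exact ⟨x, by nlinarith, h2, h3⟩
        · rw [H_cat_right hs hs1 hg0 ha0.le, hp] at hna
          exact hR a b c ha0.le (le_of_mul_le_mul_left (by linarith) hs1') hbc hc hb hna hnc

lemma IsIntegralPath.mval_cat (hs : 0 < s) (hs1 : s < 1) (hf : K.IsIntegralPath i f)
    (hg : K.IsIntegralPath i g) :
    K.mval i (LSPaper.cat s f g) = min (K.mval i f) (K.H i f 1 + K.mval i g) := by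
  have hg0 := hg.eq_zero 0 le_rfl
  have hs1' : 0 < 1 - s := by linarith
  refine IsLeast.csInf_eq ⟨?_, ?_⟩
  · obtain ⟨n, hn, ⟨x, hx0, hx1, hx⟩, -⟩ := hf.exists_min
    obtain ⟨m, hm, ⟨y, hy0, hy1, hy⟩, -⟩ := hg.exists_min
    rcases min_choice (K.mval i f) (K.H i f 1 + K.mval i g) with h | h
    · exact ⟨s * x, ⟨by positivity, by nlinarith⟩, by rw [h, H_cat_left hs hx1, hx, hn]⟩
    · exact ⟨s + (1 - s) * y, ⟨by positivity, by nlinarith⟩,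
        by rw [h, H_cat_right hs hs1 hg0 hy0, hy, hm]⟩
  · rintro _ ⟨t, ⟨ht0, ht1⟩, rfl⟩
    rcases exists_param hs hs1 t with ⟨u, hu, rfl⟩ | ⟨u, hu, rfl⟩
    · rw [H_cat_left hs hu]
      exact (min_le_left _ _).trans (hf.mval_le (nonneg_of_mul_nonneg_right ht0 hs) hu)
    · rw [H_cat_right hs hs1 hg0 hu.le]
      refine (min_le_right _ _).trans (add_le_add_right (hg.mval_le hu.le ?_) _)
      exact le_of_mul_le_mul_left (by linarith) hs1'

variable {t₀ t₁ : ℝ} {n : ℤ}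

theorem IsRootStep.cat_left (hs : 0 < s) (hs1 : s < 1) (h : K.IsRootStep i f f' t₀ t₁ n)
    (hg : g 0 = 0) (hmin : ∀ t, 0 ≤ t → t ≤ 1 → n ≤ K.H i f 1 + K.H i g t) :
    K.IsRootStep i (cat s f g) (cat s f' g) (s * t₀) (s * t₁) n where
  zero_le := mul_nonneg hs.le h.zero_le
  lt := mul_lt_mul_of_pos_left h.lt hs
  le_one := by nlinarith [h.le_one]
  start := by rw [H_cat_left hs (h.lt.le.trans h.le_one), h.start]
  finish := by rw [H_cat_left hs h.le_one, h.finish]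
  left t ht ht' := by
    obtain ⟨u, rfl⟩ : ∃ u, t = s * u := ⟨t / s, by field_simp⟩
    have hu := le_of_mul_le_mul_left ht' hs
    rw [H_cat_left hs (by linarith [h.lt, h.le_one])]
    exact h.left u (nonneg_of_mul_nonneg_right ht hs) hu
  mid t ht ht' := by
    obtain ⟨u, rfl⟩ : ∃ u, t = s * u := ⟨t / s, by field_simp⟩
    have hu := lt_of_mul_lt_mul_left ht' hs.le
    rw [H_cat_left hs (by linarith [h.le_one])]
    exact h.mid u (lt_of_mul_lt_mul_left ht hs.le) hu
  right t ht ht' := by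
    rcases exists_param hs hs1 t with ⟨u, hu, rfl⟩ | ⟨u, hu, rfl⟩
    · rw [H_cat_left hs hu]
      exact h.right u (le_of_mul_le_mul_left ht hs) hu
    · rw [H_cat_right hs hs1 hg hu.le]
      exact hmin u hu.le (le_of_mul_le_mul_left (a := 1 - s) (by linarith) (by linarith))
  eq_ite t := by
    rcases exists_param hs hs1 t with ⟨u, hu, rfl⟩ | ⟨u, hu, rfl⟩
    · simp only [H_cat_left hs hu, LSPaper.cat_left hs hu, mul_le_mul_iff_right₀ hs]
      exact h.eq_ite u
    · have h1 : s * t₁ ≤ s := by nlinarith [h.le_one]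
      have h0 : s * t₀ ≤ s * t₁ := mul_le_mul_of_nonneg_left h.lt.le hs.le
      have h2 : 0 < (1 - s) * u := mul_pos (by linarith) hu
      rw [if_neg (by linarith), if_neg (by linarith), cat_right hs hs1 hg hu.le,
        cat_right hs hs1 hg hu.le, h.eq_of_ge h.le_one]
      abel

theorem IsRootStep.cat_right (hs : 0 < s) (hs1 : s < 1) (h : K.IsRootStep i g g' t₀ t₁ n)
    (hg : g 0 = 0) {p : ℤ} (hp : K.H i f 1 = p)
    (hmin : ∀ t, 0 ≤ t → t ≤ 1 → p + n + 1 ≤ K.H i f t) :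
    K.IsRootStep i (cat s f g) (cat s f g') (s + (1 - s) * t₀) (s + (1 - s) * t₁) (p + n) := by
  have hs1' : 0 < 1 - s := by linarith
  have hg' : g' 0 = 0 := by rw [h.eq_of_le h.zero_le, hg]
  have hR : ∀ u, 0 ≤ u → K.H i (cat s f g) (s + (1 - s) * u) = p + K.H i g u := fun u hu => by
    rw [H_cat_right hs hs1 hg hu, hp]
  have hpar : ∀ t, ∃ u, t = s + (1 - s) * u := fun t =>
    ⟨(t - s) / (1 - s), by rw [mul_div_cancel₀ _ hs1'.ne']; ring⟩
  have h0 := h.zero_le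
  have hlt := h.lt
  refine ⟨by positivity, by gcongr, by nlinarith [h.le_one], ?_, ?_, ?_, ?_, ?_, ?_⟩
  · rw [hR _ h0, h.start]
    push_cast
    ring
  · rw [hR _ (h0.trans hlt.le), h.finish]
    push_cast
    ring
  · intro t ht ht'
    push_cast
    rcases exists_param hs hs1 t with ⟨u, hu, rfl⟩ | ⟨u, hu, rfl⟩
    · rw [H_cat_left hs hu]
      exact hmin u (nonneg_of_mul_nonneg_right ht hs) hu
    · rw [hR u hu.le]
      linarith [h.left u hu.le (le_of_mul_le_mul_left (by linarith) hs1')]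
  · intro t ht ht'
    push_cast
    obtain ⟨u, rfl⟩ := hpar t
    have hu : t₀ < u := lt_of_mul_lt_mul_left (a := 1 - s) (by linarith) hs1'.le
    have hu' : u < t₁ := lt_of_mul_lt_mul_left (a := 1 - s) (by linarith) hs1'.le
    rw [hR u (by linarith)]
    constructor <;> linarith [h.mid u hu hu']
  · intro t ht ht'
    push_cast
    obtain ⟨u, rfl⟩ := hpar t
    have hu : t₁ ≤ u := le_of_mul_le_mul_left (a := 1 - s) (by linarith) hs1'
    have hu' : u ≤ 1 := le_of_mul_le_mul_left (a := 1 - s) (by linarith) hs1'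
    rw [hR u (by linarith)]
    linarith [h.right u hu hu']
  · intro t
    rcases exists_param hs hs1 t with ⟨u, hu, rfl⟩ | ⟨u, hu, rfl⟩
    · have : s * u ≤ s := by nlinarith
      rw [if_pos (by nlinarith [mul_nonneg hs1'.le h0]), LSPaper.cat_left hs hu,
        LSPaper.cat_left hs hu]
    · rw [hR u hu.le]
      simp only [LSPaper.cat_right hs hs1 hg hu.le, LSPaper.cat_right hs hs1 hg' hu.le,
        add_le_add_iff_left, mul_le_mul_iff_right₀ hs1']
      rw [h.eq_ite]
      push_cast
      split_ifs
      · rfl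
      · module
      · abel

end Cat

end KacMoodyData
end LSPaper

namespace LSPaper

section Subdivision

variable {V : Type*} [AddCommGroup V]

lemma clamp01_of_mem {t : ℝ} (h0 : 0 ≤ t) (h1 : t ≤ 1) : clamp01 t = t := by
  rw [clamp01, min_eq_right h1, max_eq_right h0]

lemma clamp01_nonneg (t : ℝ) : 0 ≤ clamp01 t := le_max_left _ _

lemma clamp01_le_one (t : ℝ) : clamp01 t ≤ 1 := max_le zero_le_one (min_le_left _ _)

lemma IsClamped.apply_clamp01 {f : ℝ → V} (hf : IsClamped f) (t : ℝ) : f (clamp01 t) = f t := by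
  rcases le_total t 0 with h0 | h0
  · rw [clamp01, min_eq_right (by linarith), max_eq_left h0, hf.1 0 le_rfl, hf.1 t h0]
  rcases le_total t 1 with h1 | h1
  · rw [clamp01_of_mem h0 h1]
  · rw [clamp01, min_eq_left h1, max_eq_right zero_le_one, hf.2 t h1]

/-- On the `k`-th piece, the concatenation is a translate of the `k`-th path. -/
lemma concatList_apply {l : List (ℝ → V)} (hl : ∀ f ∈ l, IsClamped f) {k : ℕ}
    (hk : k < l.length) {u : ℝ} (hu0 : 0 ≤ u) (hu1 : u ≤ 1) :
    concatList l ((u + k) / l.length) =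
      ((l.take k).map fun f => f 1).sum + l[k] u := by
  have hm : (0 : ℝ) < l.length := by exact_mod_cast (Nat.zero_le k).trans_lt hk
  have harg : (l.length : ℝ) * ((u + k) / l.length) = u + k := mul_div_cancel₀ _ hm.ne'
  simp only [concatList, harg]
  rcases hu0.eq_or_lt with rfl | hu0
  · rw [(hl _ (List.getElem_mem hk)).1 0 le_rfl, add_zero, zero_add, Int.ceil_natCast,
      Int.toNat_natCast]
    rcases k with _ | j
    · have h1 : max 1 (min l.length 0) = 1 := by omega
      rw [h1]
      simp only [List.getD_eq_getElem _ _ hk, Nat.sub_self]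
      simpa using (hl _ (List.getElem_mem hk)).1 0 le_rfl
    · have h1 : max 1 (min l.length (j + 1)) = j + 1 := by omega
      rw [h1]
      have hj : j < l.length := by omega
      simp only [Nat.add_sub_cancel, List.getD_eq_getElem _ _ hj]
      rw [List.take_add_one, List.getElem?_eq_getElem hj, Option.toList_some, List.map_append,
        List.sum_append]
      simp
  · have hceil : ⌈u + (k : ℝ)⌉ = (k : ℤ) + 1 := by
      rw [Int.ceil_eq_iff]
      push_cast
      constructor <;> linarith
    have h1 : max 1 (min l.length ((k : ℤ) + 1).toNat) = k + 1 := by omega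
    rw [hceil, h1]
    simp only [Nat.add_sub_cancel, List.getD_eq_getElem _ _ hk]
    push_cast
    ring_nf

theorem subdiv_concatList {l : List (ℝ → V)} (hl : ∀ f ∈ l, IsClamped f) :
    subdiv l.length (concatList l) = l := by
  refine List.ext_getElem (by simp [subdiv]) fun k h1 hk => ?_
  funext t
  have hc := hl _ (List.getElem_mem hk)
  have h0 := concatList_apply hl hk le_rfl zero_le_one
  rw [zero_add] at h0
  have h2 : (subdiv l.length (concatList l))[k] t =
      concatList l ((clamp01 t + k) / l.length) - concatList l (k / l.length) :=
    congrFun (List.getElem_ofFn h1) t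
  rw [h2, concatList_apply hl hk (clamp01_nonneg t) (clamp01_le_one t), h0, hc.1 0 le_rfl,
    hc.apply_clamp01, add_zero, add_sub_cancel_left]

lemma concatList_one {l : List (ℝ → V)} (hne : l ≠ []) (hl : ∀ f ∈ l, IsClamped f) :
    concatList l 1 = tensWt l := by
  have hk : l.length - 1 < l.length := Nat.sub_one_lt (List.length_pos_iff.2 hne).ne'
  have h := concatList_apply hl hk zero_le_one le_rfl
  rw [← Nat.cast_one, ← Nat.cast_add, Nat.add_sub_cancel' (by omega),
    div_self (by exact_mod_cast (by omega : l.length ≠ 0)), Nat.cast_one] at h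
  rw [h, tensWt, List.getElem_length_sub_one_eq_getLast]
  conv_rhs => rw [← List.dropLast_append_getLast hne, List.map_append, List.sum_append,
    List.dropLast_eq_take]
  simp

end Subdivision

namespace KacMoodyData

section Tensor

variable {I V : Type*} [Fintype I] [DecidableEq I] [AddCommGroup V] [Module ℝ V]
variable {K : KacMoodyData I V} {i : I}

namespace IsIntegralPath

variable {s : ℝ} {f g : ℝ → V}

lemma isClamped (hf : K.IsIntegralPath i f) : IsClamped f := ⟨hf.eq_zero, hf.eq_one⟩

lemma isIntegralPath_of_eop (hf : K.IsIntegralPath i f) (h : K.eop i f = some g) :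
    K.IsIntegralPath i g := by
  obtain ⟨t₀, t₁, n, hs⟩ := hf.exists_of_eop h
  exact hs.isIntegralPath_target hf

lemma isIntegralPath_of_fop (hf : K.IsIntegralPath i f) (h : K.fop i f = some g) :
    K.IsIntegralPath i g := by
  obtain ⟨t₀, t₁, n, hs⟩ := hf.exists_of_fop h
  exact hs.isIntegralPath_source hf

lemma eop_cat_of_le (hs : 0 < s) (hs1 : s < 1) (hf : K.IsIntegralPath i f)
    (hg : K.IsIntegralPath i g) (hle : K.mval i f ≤ K.H i f 1 + K.mval i g) :
    K.eop i (LSPaper.cat s f g) = (K.eop i f).map fun f' => LSPaper.cat s f' g := by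
  by_cases h0 : K.mval i f = 0
  · rw [eop, hf.mval_cat hs hs1 hg, min_eq_left hle, if_pos h0, eop, if_pos h0, Option.map_none]
  · obtain ⟨f', t₀, t₁, n, h⟩ := hf.exists_raise h0
    rw [h.eop_eq (hf.eq_zero 0 le_rfl), Option.map_some]
    refine (h.cat_left hs hs1 (hg.eq_zero 0 le_rfl) fun t ht ht' => ?_).eop_eq
      ((hf.cat hs hs1 hg).eq_zero 0 le_rfl)
    rw [← h.mval_eq]
    linarith [hg.mval_le ht ht']

lemma eop_cat_of_lt (hs : 0 < s) (hs1 : s < 1) (hf : K.IsIntegralPath i f)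
    (hg : K.IsIntegralPath i g) (hlt : K.H i f 1 + K.mval i g < K.mval i f) :
    K.eop i (LSPaper.cat s f g) = (K.eop i g).map fun g' => LSPaper.cat s f g' := by
  have h0 : K.mval i g ≠ 0 := by linarith [hf.mval_le zero_le_one le_rfl]
  obtain ⟨g', t₀, t₁, n, h⟩ := hg.exists_raise h0
  obtain ⟨p, hp⟩ := hf.int_one
  obtain ⟨m, hm, -⟩ := hf.exists_min
  rw [h.eop_eq (hg.eq_zero 0 le_rfl), Option.map_some]
  refine (h.cat_right hs hs1 (hg.eq_zero 0 le_rfl) hp fun t ht ht' => ?_).eop_eq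
    ((hf.cat hs hs1 hg).eq_zero 0 le_rfl)
  refine le_trans ?_ (hf.mval_le ht ht')
  rw [h.mval_eq, hp, hm] at hlt
  rw [hm]
  have : p + n < m := by exact_mod_cast hlt
  exact_mod_cast this

lemma fop_cat_of_lt (hs : 0 < s) (hs1 : s < 1) (hf : K.IsIntegralPath i f)
    (hg : K.IsIntegralPath i g) (hlt : K.mval i f < K.H i f 1 + K.mval i g) :
    K.fop i (LSPaper.cat s f g) = (K.fop i f).map fun f' => LSPaper.cat s f' g := by
  obtain ⟨f', t₀, t₁, n, h⟩ := hf.exists_lower (by linarith [hg.mval_nonpos])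
  rw [h.fop_eq, Option.map_some]
  refine (h.cat_left hs hs1 (hg.eq_zero 0 le_rfl) fun t ht ht' => ?_).fop_eq
  obtain ⟨p, hp⟩ := hf.int_one
  obtain ⟨m, hm, -⟩ := hg.exists_min
  have hp' := h.H_of_ge h.le_one
  have hgt := hg.mval_le ht ht'
  rw [h.mval_target_eq, hp, hm] at hlt
  have h1 : n + 1 < p + m := by exact_mod_cast hlt
  have h2 : (n : ℝ) + 1 + 1 ≤ p + m := by exact_mod_cast h1
  linarith

lemma fop_cat_of_le (hs : 0 < s) (hs1 : s < 1) (hf : K.IsIntegralPath i f)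
    (hg : K.IsIntegralPath i g) (hle : K.H i f 1 + K.mval i g ≤ K.mval i f) :
    K.fop i (LSPaper.cat s f g) = (K.fop i g).map fun g' => LSPaper.cat s f g' := by
  by_cases h0 : K.H i g 1 = K.mval i g
  · rw [fop, hf.mval_cat hs hs1 hg, min_eq_right hle, H_cat_one hs hs1 (hg.eq_zero 0 le_rfl), h0,
      sub_self, if_pos rfl, fop, h0, sub_self, if_pos rfl, Option.map_none]
  · obtain ⟨g', t₀, t₁, n, h⟩ := hg.exists_lower h0
    obtain ⟨p, hp⟩ := hf.int_one
    rw [h.fop_eq, Option.map_some]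
    refine (h.cat_right hs hs1 ((h.isIntegralPath_source hg).eq_zero 0 le_rfl) hp
      fun t ht ht' => ?_).fop_eq
    rw [h.mval_target_eq, hp] at hle
    linarith [hf.mval_le ht ht']

end IsIntegralPath

lemma tensE_spec {l l' : List (ℝ → V)} (hl : ∀ f ∈ l, K.IsIntegralPath i f)
    (h : K.tensE i l = some l') : l'.length = l.length ∧ ∀ f ∈ l', K.IsIntegralPath i f := by
  induction l generalizing l' with
  | nil => simp [tensE] at h
  | cons b l ih =>
    rw [List.forall_mem_cons] at hl
    rcases l with _ | ⟨c, rest⟩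
    · obtain ⟨b', hb', rfl⟩ := Option.map_eq_some_iff.1 h
      exact ⟨rfl, by simpa using hl.1.isIntegralPath_of_eop hb'⟩
    · rw [tensE] at h
      split_ifs at h
      · obtain ⟨b', hb', rfl⟩ := Option.map_eq_some_iff.1 h
        exact ⟨rfl, List.forall_mem_cons.2 ⟨hl.1.isIntegralPath_of_eop hb', hl.2⟩⟩
      · obtain ⟨r', hr', rfl⟩ := Option.map_eq_some_iff.1 h
        obtain ⟨h1, h2⟩ := ih hl.2 hr'
        exact ⟨congrArg (· + 1) h1, List.forall_mem_cons.2 ⟨hl.1, h2⟩⟩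

lemma tensF_spec {l l' : List (ℝ → V)} (hl : ∀ f ∈ l, K.IsIntegralPath i f)
    (h : K.tensF i l = some l') : l'.length = l.length ∧ ∀ f ∈ l', K.IsIntegralPath i f := by
  induction l generalizing l' with
  | nil => simp [tensF] at h
  | cons b l ih =>
    rw [List.forall_mem_cons] at hl
    rcases l with _ | ⟨c, rest⟩
    · obtain ⟨b', hb', rfl⟩ := Option.map_eq_some_iff.1 h
      exact ⟨rfl, by simpa using hl.1.isIntegralPath_of_fop hb'⟩
    · rw [tensF] at h
      split_ifs at h
      · obtain ⟨b', hb', rfl⟩ := Option.map_eq_some_iff.1 h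
        exact ⟨rfl, List.forall_mem_cons.2 ⟨hl.1.isIntegralPath_of_fop hb', hl.2⟩⟩
      · obtain ⟨r', hr', rfl⟩ := Option.map_eq_some_iff.1 h
        obtain ⟨h1, h2⟩ := ih hl.2 hr'
        exact ⟨congrArg (· + 1) h1, List.forall_mem_cons.2 ⟨hl.1, h2⟩⟩

/-- The concatenation of integral paths is an integral path, and the tensor product rule computes
its crystal structure. -/
theorem concatList_crystal {l : List (ℝ → V)} (hne : l ≠ [])
    (hl : ∀ f ∈ l, K.IsIntegralPath i f) :
    K.IsIntegralPath i (concatList l) ∧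
      K.tensEps i l = K.epsilon i (concatList l) ∧ K.tensPhi i l = K.phi i (concatList l) ∧
      K.eop i (concatList l) = (K.tensE i l).map concatList ∧
      K.fop i (concatList l) = (K.tensF i l).map concatList := by
  induction l with
  | nil => exact absurd rfl hne
  | cons b l ih =>
    have hb := hl b List.mem_cons_self
    rcases l with _ | ⟨c, rest⟩
    · refine ⟨by rwa [concatList_singleton],
        by simp [concatList_singleton, tensEps], by simp [concatList_singleton, tensPhi], ?_, ?_⟩
      · rw [concatList_singleton, tensE, Option.map_map]
        simp [Function.comp_def, concatList_singleton]
      · rw [concatList_singleton, tensF, Option.map_map]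
        simp [Function.comp_def, concatList_singleton]
    · obtain ⟨hr, heps, hphi, he, hf⟩ := ih (List.cons_ne_nil _ _)
        fun f hf => hl f (List.mem_cons_of_mem b hf)
      have hclamp : ∀ f ∈ c :: rest, IsClamped f := fun f hf =>
        (hl f (List.mem_cons_of_mem b hf)).isClamped
      have hs : (0 : ℝ) < 1 / ((rest.length : ℝ) + 2) := by positivity
      have hs1 : 1 / ((rest.length : ℝ) + 2) < 1 := by
        rw [div_lt_one (by positivity)]
        linarith [(rest.length.cast_nonneg : (0 : ℝ) ≤ _)]
      have hr0 := hr.eq_zero 0 le_rfl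
      have hcat := hb.cat hs hs1 hr
      have hmval := hb.mval_cat hs hs1 hr
      have hone := K.H_cat_one (i := i) (f := b) hs hs1 hr0
      obtain ⟨p, hp⟩ := hb.int_one
      obtain ⟨q, hq⟩ := hr.int_one
      have hbe := hb.epsilon_eq
      have hbp := hb.phi_eq
      have hre := hr.epsilon_eq
      have hrp := hr.phi_eq
      have hp' : ⌊K.coroot i (b 1)⌋ = p := by
        rw [← H, hp, Int.floor_intCast]
      have hq' : ⌊K.coroot i (tensWt (c :: rest))⌋ = q := by
        rw [← concatList_one (List.cons_ne_nil _ _) hclamp, ← H, hq, Int.floor_intCast]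
      rw [concatList_cons_cons]
      refine ⟨hcat, ?_, ?_, ?_, ?_⟩
      · rw [tensEps, heps, hp']
        have : ((max (K.epsilon i b : ℤ) (K.epsilon i (concatList (c :: rest)) - p) : ℤ) : ℝ) =
            K.epsilon i (cat (1 / ((rest.length : ℝ) + 2)) b (concatList (c :: rest))) := by
          rw [hcat.epsilon_eq, hmval]
          push_cast
          rw [hbe, hre, ← hp, ← max_neg_neg]
          congr 1
          ring
        exact_mod_cast this
      · rw [tensPhi, hphi, hq']
        have : ((max (K.phi i (concatList (c :: rest)) : ℤ) (K.phi i b + q) : ℤ) : ℝ) =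
            K.phi i (cat (1 / ((rest.length : ℝ) + 2)) b (concatList (c :: rest))) := by
          rw [hcat.phi_eq, hmval, hone]
          push_cast
          rw [hbp, hrp, ← hq, sub_eq_add_neg _ (min _ _), ← max_neg_neg, ← max_add_add_left,
            max_comm]
          congr 1 <;> ring
        exact_mod_cast this
      · have hcond : K.tensEps i (c :: rest) ≤ (K.phi i b : ℤ) ↔
            K.mval i b ≤ K.H i b 1 + K.mval i (concatList (c :: rest)) := by
          rw [heps, ← Int.cast_le (R := ℝ), Int.cast_natCast, Int.cast_natCast, hre, hbp]
          constructor <;> intro <;> linarith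
        rw [tensE]
        by_cases h : K.mval i b ≤ K.H i b 1 + K.mval i (concatList (c :: rest))
        · rw [if_pos (hcond.2 h), hb.eop_cat_of_le hs hs1 hr h, Option.map_map]
          simp only [Function.comp_def, concatList_cons_cons]
        · rw [if_neg (hcond.not.2 h), hb.eop_cat_of_lt hs hs1 hr (not_le.1 h), he, Option.map_map,
            Option.map_map]
          refine Option.map_congr fun r' hr' => ?_
          exact (concatList_cons b (tensE_spec (List.forall_mem_cons.1 hl).2 hr').1).symm
      · have hcond : K.tensEps i (c :: rest) < (K.phi i b : ℤ) ↔
            K.mval i b < K.H i b 1 + K.mval i (concatList (c :: rest)) := by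
          rw [heps, ← Int.cast_lt (R := ℝ), Int.cast_natCast, Int.cast_natCast, hre, hbp]
          constructor <;> intro <;> linarith
        rw [tensF]
        by_cases h : K.mval i b < K.H i b 1 + K.mval i (concatList (c :: rest))
        · rw [if_pos (hcond.2 h), hb.fop_cat_of_lt hs hs1 hr h, Option.map_map]
          simp only [Function.comp_def, concatList_cons_cons]
        · rw [if_neg (hcond.not.2 h), hb.fop_cat_of_le hs hs1 hr (not_lt.1 h), hf, Option.map_map,
            Option.map_map]
          refine Option.map_congr fun r' hr' => ?_
          exact (concatList_cons b (tensF_spec (List.forall_mem_cons.1 hl).2 hr').1).symm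

lemma isClamped_of_mem_B {μ : V} {f : ℝ → V} (hf : f ∈ K.B μ) : IsClamped f := by
  obtain ⟨π, rfl⟩ := hf
  exact π.isClamped

lemma isIntegralPath_of_mem_B {μ : V} (hμ : μ ∈ K.P) {f : ℝ → V} (hf : f ∈ K.B μ) (i : I) :
    K.IsIntegralPath i f := by
  obtain ⟨π, rfl⟩ := hf
  exact π.isIntegralPath hμ i

/-- The effect of `ẽ_i` on the weight and on the string lengths. -/
lemma IsIntegralPath.crystal_of_eop {f g : ℝ → V} (hf : K.IsIntegralPath i f)
    (h : K.eop i f = some g) :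
    g 1 = f 1 + K.α i ∧ K.epsilon i g + 1 = K.epsilon i f ∧ K.phi i g = K.phi i f + 1 ∧
      K.fop i g = some f := by
  obtain ⟨t₀, t₁, n, hs⟩ := hf.exists_of_eop h
  have hg := hs.isIntegralPath_target hf
  refine ⟨hs.eq_of_ge hs.le_one, ?_, ?_, hs.fop_eq⟩
  · have : (K.epsilon i g : ℝ) + 1 = K.epsilon i f := by
      rw [hf.epsilon_eq, hg.epsilon_eq, hs.mval_eq, hs.mval_target_eq]
      ring
    exact_mod_cast this
  · have : (K.phi i g : ℝ) = K.phi i f + 1 := by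
      rw [hf.phi_eq, hg.phi_eq, hs.mval_eq, hs.mval_target_eq, hs.H_of_ge hs.le_one]
      ring
    exact_mod_cast this

/-- The effect of `f̃_i` on the weight and on the string lengths. -/
lemma IsIntegralPath.crystal_of_fop {f g : ℝ → V} (hf : K.IsIntegralPath i f)
    (h : K.fop i f = some g) :
    g 1 = f 1 - K.α i ∧ K.epsilon i g = K.epsilon i f + 1 ∧ K.phi i g + 1 = K.phi i f ∧
      K.eop i g = some f := by
  obtain ⟨t₀, t₁, n, hs⟩ := hf.exists_of_fop h
  have hg := hs.isIntegralPath_source hf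
  have he := hs.eop_eq (hg.eq_zero 0 le_rfl)
  obtain ⟨h1, h2, h3, -⟩ := hg.crystal_of_eop he
  exact ⟨eq_sub_of_add_eq h1.symm, h2.symm, h3.symm, he⟩

end Tensor

end KacMoodyData
end LSPaper

open LSPaper in
theorem statement9 {I V : Type*} [Fintype I] [DecidableEq I] [AddCommGroup V] [Module ℝ V]
    (K : KacMoodyData I V) (μ : V) (hμ : μ ∈ K.P)
    (m : ℕ) (hm : 1 ≤ m) :
    (∀ π ∈ K.ConcatSet μ m, ∀ i : I,
      (∀ g, K.eop i π = some g →
        g 1 = π 1 + K.α i ∧ K.epsilon i g + 1 = K.epsilon i π ∧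
        K.phi i g = K.phi i π + 1 ∧ K.fop i g = some π) ∧
      (∀ g, K.fop i π = some g →
        g 1 = π 1 - K.α i ∧ K.epsilon i g = K.epsilon i π + 1 ∧
        K.phi i g + 1 = K.phi i π ∧ K.eop i g = some π) ∧
      (K.phi i π : ℝ) - (K.epsilon i π : ℝ) = K.coroot i (π 1)) ∧
    Set.BijOn (subdiv m) (K.ConcatSet μ m)
      {l : List (ℝ → V) | l.length = m ∧ ∀ f ∈ l, f ∈ K.B μ} ∧
    (∀ π ∈ K.ConcatSet μ m,
      tensWt (subdiv m π) = π 1 ∧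
      ∀ i : I,
        K.tensEps i (subdiv m π) = (K.epsilon i π : ℤ) ∧
        K.tensPhi i (subdiv m π) = (K.phi i π : ℤ) ∧
        K.tensE i (subdiv m π) = (K.eop i π).map (subdiv m) ∧
        K.tensF i (subdiv m π) = (K.fop i π).map (subdiv m)) := by
  have hone : ∀ l : List (ℝ → V), l.length = m → l ≠ [] := fun l hl h => by
    rw [h, List.length_nil] at hl
    omega
  have hB : ∀ l : List (ℝ → V), (∀ f ∈ l, f ∈ K.B μ) → ∀ i, ∀ f ∈ l, K.IsIntegralPath i f :=
    fun l hl i f hf => KacMoodyData.isIntegralPath_of_mem_B hμ (hl f hf) i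
  have hcl : ∀ l : List (ℝ → V), (∀ f ∈ l, f ∈ K.B μ) → ∀ f ∈ l, IsClamped f :=
    fun l hl f hf => KacMoodyData.isClamped_of_mem_B (hl f hf)
  refine ⟨?_, ⟨?_, ?_, ?_⟩, ?_⟩
  · rintro _ ⟨l, hlm, hl, rfl⟩ i
    have hint := (KacMoodyData.concatList_crystal (hone l hlm) (hB l hl i)).1
    exact ⟨fun g hg => hint.crystal_of_eop hg, fun g hg => hint.crystal_of_fop hg, by
      rw [hint.phi_eq, hint.epsilon_eq, KacMoodyData.H]
      ring⟩
  · rintro _ ⟨l, rfl, hl, rfl⟩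
    rw [subdiv_concatList (hcl l hl)]
    exact ⟨rfl, hl⟩
  · rintro _ ⟨l, hlm, hl, rfl⟩ _ ⟨l', hlm', hl', rfl⟩ h
    have e := subdiv_concatList (hcl l hl)
    have e' := subdiv_concatList (hcl l' hl')
    rw [hlm] at e
    rw [hlm'] at e'
    rw [e, e'] at h
    rw [h]
  · rintro l ⟨hlm, hl⟩
    have e := subdiv_concatList (hcl l hl)
    rw [hlm] at e
    exact ⟨concatList l, ⟨l, hlm, hl, rfl⟩, e⟩
  · rintro _ ⟨l, rfl, hl, rfl⟩
    rw [subdiv_concatList (hcl l hl)]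
    refine ⟨(concatList_one (hone l rfl) (hcl l hl)).symm, fun i => ?_⟩
    · obtain ⟨-, h1, h2, h3, h4⟩ := KacMoodyData.concatList_crystal (hone l rfl) (hB l hl i)
      refine ⟨h1, h2, ?_, ?_⟩
      · rw [h3, Option.map_map]
        refine (Option.map_congr (g := id) fun l' hl' => ?_).trans (Option.map_id_apply)|>.symm
        obtain ⟨e1, e2⟩ := KacMoodyData.tensE_spec (hB l hl i) hl'
        rw [Function.comp_apply, ← e1, subdiv_concatList fun f hf => (e2 f hf).isClamped, id]
      · rw [h4, Option.map_map]
        refine (Option.map_congr (g := id) fun l' hl' => ?_).trans (Option.map_id_apply)|>.symm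
        obtain ⟨e1, e2⟩ := KacMoodyData.tensF_spec (hB l hl i) hl'
        rw [Function.comp_apply, ← e1, subdiv_concatList fun f hf => (e2 f hf).isClamped, id]
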